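/- arXiv:1308.6596 — 2 statements merged into one kernel-verified Lean document; each statement's English description precedes it below -/
import Mathlib

section
/- Let δ be a Weitzenböck derivation of the free metabelian associative algebra F_d. Then the vector space of constants (F_d')^δ = {f ∈ F_d' : δ(f) = 0} is a finitely generated module over the algebra of constants K[U_d,V_d]^δ = {h ∈ K[U_d,V_d] : δ(h) = 0}. -/
noncomputable section

/-- The metabelian relation on the free associative algebra:
products of two commutators are identified with zero. -/
def MetabRel (K : Type*) [CommRing K] (d : ℕ) (p q : FreeAlgebra K (Fin d)) : Prop :=
  q = 0 ∧ ∃ a b c e : FreeAlgebra K (Fin d), p = (a * b - b * a) * (c * e - e * c)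

/-- The free metabelian associative algebra `F_d = A_d/(A_d')²`. -/
abbrev FreeMetab (K : Type*) [CommRing K] (d : ℕ) := RingQuot (MetabRel K d)

/-- The free generators `x_i` of `F_d`. -/
def xg (K : Type*) [CommRing K] (d : ℕ) (i : Fin d) : FreeMetab K d :=
  RingQuot.mkAlgHom K (MetabRel K d) (FreeAlgebra.ι K i)

/-- The commutator ideal `F_d'`: the two-sided ideal generated by all commutators. -/
def commIdeal (K : Type*) [CommRing K] (d : ℕ) : Ideal (FreeMetab K d) :=
  Ideal.span {z | ∃ a f g b : FreeMetab K d, z = a * (f * g - g * f) * b}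

/-- `K[U_d,V_d]`. -/
abbrev PolyUV (K : Type*) [CommRing K] (d : ℕ) := MvPolynomial (Fin d ⊕ Fin d) K

def uP (K : Type*) [CommRing K] (d : ℕ) (i : Fin d) : PolyUV K d := MvPolynomial.X (Sum.inl i)
def vP (K : Type*) [CommRing K] (d : ℕ) (i : Fin d) : PolyUV K d := MvPolynomial.X (Sum.inr i)

/-- Action of a monomial of `K[U_d,V_d]` on `F_d`, implementing
`f·u_i = x_i f` and `f·v_i = [f,x_i]` (on the commutator ideal all the
individual operators commute, so the fixed order of composition is immaterial). -/
def monAct (K : Type*) [CommRing K] (d : ℕ) (m : (Fin d ⊕ Fin d) →₀ ℕ) :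
    Module.End K (FreeMetab K d) :=
  (List.ofFn fun i : Fin d =>
      (LinearMap.mulLeft K (xg K d i) : Module.End K (FreeMetab K d)) ^ m (Sum.inl i)).prod *
  (List.ofFn fun i : Fin d =>
      (LinearMap.mulRight K (xg K d i) - LinearMap.mulLeft K (xg K d i) :
        Module.End K (FreeMetab K d)) ^ m (Sum.inr i)).prod

/-- The action of `K[U_d,V_d]` on the commutator ideal of `F_d`. -/
def act (K : Type*) [CommRing K] (d : ℕ) (p : PolyUV K d) (w : FreeMetab K d) : FreeMetab K d :=
  ∑ m ∈ p.support, p.coeff m • (monAct K d m w)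


/-! ### sl2 generalities -/

namespace Wz

/-- The relations of an `sl2`-triple of linear operators. -/
structure Sl2 {K V : Type*} [Field K] [AddCommGroup V] [Module K V]
    (e f h : V →ₗ[K] V) : Prop where
  ef : ∀ v, e (f v) - f (e v) = h v
  he : ∀ v, h (e v) - e (h v) = (2 : K) • e v
  hf : ∀ v, h (f v) - f (h v) = -((2 : K) • f v)

/-- Local nilpotency. -/
def LocNil {K V : Type*} [Field K] [AddCommGroup V] [Module K V] (e : V →ₗ[K] V) : Prop :=
  ∀ v, ∃ n : ℕ, (e ^ n) v = 0

/-- The span of the eigenvectors with integer eigenvalues. -/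
def IntSp {K V : Type*} [Field K] [AddCommGroup V] [Module K V] (h : V →ₗ[K] V) :
    Submodule K V :=
  Submodule.span K {v | ∃ k : ℤ, h v = (k : K) • v}

/-- Diagonalizability with integer eigenvalues. -/
def IntDiag {K V : Type*} [Field K] [AddCommGroup V] [Module K V] (h : V →ₗ[K] V) : Prop :=
  ∀ v, v ∈ IntSp h

section basic
variable {K V W : Type*} [Field K] [AddCommGroup V] [Module K V] [AddCommGroup W] [Module K W]

/-- The subspace of locally nilpotent vectors. -/
def nilSub (e : V →ₗ[K] V) : Submodule K V where
  carrier := {v | ∃ n : ℕ, (e ^ n) v = 0}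
  zero_mem' := ⟨0, by simp⟩
  add_mem' := by
    rintro a b ⟨n, hn⟩ ⟨m, hm⟩
    refine ⟨n + m, ?_⟩
    rw [map_add]
    nth_rw 1 [add_comm n m]
    rw [pow_add, pow_add, Module.End.mul_apply, Module.End.mul_apply, hn, hm]
    simp
  smul_mem' := by
    rintro c a ⟨n, hn⟩
    exact ⟨n, by rw [map_smul, hn, smul_zero]⟩

lemma pow_intertwine (φ : V →ₗ[K] W) (a : V →ₗ[K] V) (b : W →ₗ[K] W)
    (hab : ∀ v, b (φ v) = φ (a v)) (n : ℕ) (v : V) : (b ^ n) (φ v) = φ ((a ^ n) v) := by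
  induction n generalizing v with
  | zero => simp
  | succ n ih => rw [pow_succ, pow_succ, Module.End.mul_apply, Module.End.mul_apply, hab, ih]

lemma intSp_map (φ : V →ₗ[K] W) (a : V →ₗ[K] V) (b : W →ₗ[K] W)
    (hab : ∀ v, b (φ v) = φ (a v)) (v : V) (hv : v ∈ IntSp a) : φ v ∈ IntSp b := by
  unfold IntSp at hv
  induction hv using Submodule.span_induction with
  | mem x hx =>
    obtain ⟨k, hk⟩ := hx
    exact Submodule.subset_span ⟨k, by rw [hab, hk, map_smul]⟩
  | zero => simp
  | add x y _ _ hx hy => rw [map_add]; exact Submodule.add_mem _ hx hy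
  | smul c x _ hx => rw [map_smul]; exact Submodule.smul_mem _ _ hx

/-- The conclusion of the Jacobson-Morozov theorem. -/
def JM (e : V →ₗ[K] V) : Prop :=
  ∃ f h : V →ₗ[K] V, Sl2 e f h ∧ LocNil f ∧ IntDiag h

lemma JM.transport (φ : V ≃ₗ[K] W) (a : V →ₗ[K] V) (b : W →ₗ[K] W)
    (hab : ∀ v, b (φ v) = φ (a v)) (h : JM a) : JM b := by
  obtain ⟨f, h, hs, hf, hh⟩ := h
  have hb : ∀ w, b w = φ (a (φ.symm w)) := fun w => by rw [← hab]; simp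
  refine ⟨φ.toLinearMap ∘ₗ f ∘ₗ φ.symm.toLinearMap, φ.toLinearMap ∘ₗ h ∘ₗ φ.symm.toLinearMap,
    ⟨?_, ?_, ?_⟩, ?_, ?_⟩
  · intro v
    simp [hb, ← map_sub, hs.ef]
  · intro v
    simp [hb, ← map_sub, hs.he]
  · intro v
    simp [← map_sub, hs.hf]
  · intro v
    obtain ⟨n, hn⟩ := hf (φ.symm v)
    refine ⟨n, ?_⟩
    have := pow_intertwine φ.toLinearMap f (φ.toLinearMap ∘ₗ f ∘ₗ φ.symm.toLinearMap)
      (by intro v; simp) n (φ.symm v)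
    simpa [hn] using this
  · intro v
    have := intSp_map φ.toLinearMap h (φ.toLinearMap ∘ₗ h ∘ₗ φ.symm.toLinearMap)
      (by intro v; simp) (φ.symm v) (hh _)
    simpa using this

open DirectSum in
lemma JM.directSum {ι : Type*} [DecidableEq ι] {V : ι → Type*} [∀ i, AddCommGroup (V i)]
    [∀ i, Module K (V i)] (e : ∀ i, V i →ₗ[K] V i) (h : ∀ i, JM (e i)) :
    JM (V := ⨁ i, V i) (DirectSum.lmap e) := by
  choose f h hs hf hh using h
  refine ⟨DirectSum.lmap f, DirectSum.lmap h, ⟨?_, ?_, ?_⟩, ?_, ?_⟩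
  · intro v
    ext i
    simp [← (hs i).ef]
  · intro v
    ext i
    simp [DirectSum.smul_apply, ← (hs i).he]
  · intro v
    ext i
    have := (hs i).hf (v i)
    change (lmap h (lmap f v)) i - (lmap f (lmap h v)) i = -((2 : K) • (lmap f v) i)
    simpa using this
  · intro v
    change v ∈ nilSub (DirectSum.lmap f)
    induction v using DirectSum.induction_on with
    | zero => exact Submodule.zero_mem _
    | of i x =>
      obtain ⟨n, hn⟩ := hf i x
      refine ⟨n, ?_⟩
      have := pow_intertwine (DirectSum.lof K ι V i) (f i) (DirectSum.lmap f)
        (by intro v; simp) n x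
      rw [hn, map_zero] at this
      exact this
    | add x y hx hy => exact Submodule.add_mem _ hx hy
  · intro v
    induction v using DirectSum.induction_on with
    | zero => exact Submodule.zero_mem _
    | of i x =>
      exact intSp_map (DirectSum.lof K ι V i) (h i) (DirectSum.lmap h)
        (by intro v; simp) x (hh i x)
    | add x y hx hy => exact Submodule.add_mem _ hx hy

open Polynomial in
lemma JM.quot (k : ℕ) :
    JM (K := K) (V := K[X] ⧸ Submodule.span K[X] {(X : K[X]) ^ k})
      (LinearMap.lsmul K[X] _ (X : K[X])|>.restrictScalars K) := by
  classical
  set I := Submodule.span K[X] {(X : K[X]) ^ k} with hI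
  have hmem : ∀ p : K[X], p ∈ I ↔ ∃ q, p = X ^ k * q := by
    intro p
    rw [hI, Submodule.mem_span_singleton]
    constructor
    · rintro ⟨q, rfl⟩; exact ⟨q, by rw [smul_eq_mul, mul_comm]⟩
    · rintro ⟨q, rfl⟩; exact ⟨q, by rw [smul_eq_mul, mul_comm]⟩
  let D : K[X] →ₗ[K] K[X] := derivative
  let m : K[X] →ₗ[K] K[X] := LinearMap.mulLeft K X
  let h0 : K[X] →ₗ[K] K[X] := (2 : K) • (m ∘ₗ D) - ((k : K) - 1) • LinearMap.id
  let f0 : K[X] →ₗ[K] K[X] := ((k : K) - 1) • D - m ∘ₗ D ∘ₗ D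
  have hh0 : ∀ p, h0 p = C 2 * (X * derivative p) - C ((k : K) - 1) * p := by
    intro p; simp only [h0, m, D]; simp [smul_eq_C_mul]
  have hf0 : ∀ p, f0 p = C ((k : K) - 1) * derivative p - X * derivative (derivative p) := by
    intro p; simp only [f0, m, D]; simp [smul_eq_C_mul]
  have hh : I.restrictScalars K ≤ (I.restrictScalars K).comap h0 := by
    intro p hp
    obtain ⟨q, rfl⟩ := (hmem p).1 hp
    refine (hmem _).2 ?_
    rw [hh0]
    rcases k with _ | k
    · exact ⟨_, (by intro z; rw [pow_zero, one_mul] : ∀ z : K[X], z = X ^ 0 * z) _⟩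
    · refine ⟨C 2 * ((k + 1 : K[X]) * q + X * derivative q) - C (((k + 1 : ℕ) : K) - 1) * q, ?_⟩
      simp [derivative_mul]
      ring
  have hf : I.restrictScalars K ≤ (I.restrictScalars K).comap f0 := by
    intro p hp
    obtain ⟨q, rfl⟩ := (hmem p).1 hp
    refine (hmem _).2 ?_
    rw [hf0]
    rcases k with _ | _ | k
    · exact ⟨_, (by intro z; rw [pow_zero, one_mul] : ∀ z : K[X], z = X ^ 0 * z) _⟩
    · refine ⟨- (2 * derivative q) - X * derivative (derivative q), ?_⟩
      simp [derivative_mul]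
      ring
    · refine ⟨(k + 1 : K[X]) * derivative q - 2 * (k + 2 : K[X]) * derivative q
        - X * derivative (derivative q), ?_⟩
      simp [derivative_mul]
      ring
  let fq : (K[X] ⧸ I) →ₗ[K] (K[X] ⧸ I) := (I.restrictScalars K).mapQ (I.restrictScalars K) f0 hf
  let hq : (K[X] ⧸ I) →ₗ[K] (K[X] ⧸ I) := (I.restrictScalars K).mapQ (I.restrictScalars K) h0 hh
  let π : K[X] →ₗ[K] (K[X] ⧸ I) := I.mkQ.restrictScalars K
  have hπ : Function.Surjective π := I.mkQ_surjective
  have hfq : ∀ p, fq (π p) = π (f0 p) := fun p => rfl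
  have hhq : ∀ p, hq (π p) = π (h0 p) := fun p => rfl
  have heq : ∀ p, ((LinearMap.lsmul K[X] (K[X] ⧸ I) (X : K[X])).restrictScalars K) (π p)
      = π (X * p) := fun p => rfl
  refine ⟨fq, hq, ⟨?_, ?_, ?_⟩, ?_, ?_⟩
  · intro v
    obtain ⟨p, rfl⟩ := hπ v
    rw [hfq, heq, heq, hfq, hhq, ← map_sub]
    congr 1
    rw [hf0, hf0, hh0]
    have hC : (C 2 : K[X]) = 2 := rfl
    simp [derivative_mul, hC]
    ring
  · intro v
    obtain ⟨p, rfl⟩ := hπ v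
    rw [hhq, heq, heq, hhq, ← map_sub, ← map_smul]
    congr 1
    rw [hh0, hh0, smul_eq_C_mul]
    simp [derivative_mul]
    ring
  · intro v
    obtain ⟨p, rfl⟩ := hπ v
    rw [hhq, hfq, hfq, hhq, ← map_sub, ← map_smul, ← map_neg]
    congr 1
    rw [hh0, hh0, hf0, hf0, smul_eq_C_mul]
    simp [derivative_mul]
    ring
  · intro v
    obtain ⟨p, rfl⟩ := hπ v
    have key : ∀ n : ℕ, ∀ c : K, C c * X ^ n ∈ nilSub f0 := by
      intro n
      induction n with
      | zero => intro c; exact ⟨1, by rw [pow_one, hf0]; simp⟩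
      | succ n ih =>
        intro c
        have : f0 (C c * X ^ (n + 1)) = C (c * (((k : K) - 1) * (n + 1) - (n + 1) * n)) * X ^ n := by
          rw [hf0]
          rcases n with _ | n
          · simp; ring
          · simp; ring
        obtain ⟨N, hN⟩ := ih (c * (((k : K) - 1) * (n + 1) - (n + 1) * n))
        exact ⟨N + 1, by rw [pow_succ, Module.End.mul_apply, this, hN]⟩
    have : p ∈ nilSub f0 := by
      induction p using Polynomial.induction_on' with
      | add p q hp hq => exact Submodule.add_mem _ hp hq
      | monomial n a => rw [← C_mul_X_pow_eq_monomial]; exact key n a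
    obtain ⟨n, hn⟩ := this
    exact ⟨n, by rw [pow_intertwine π f0 fq hfq, hn, map_zero]⟩
  · intro v
    obtain ⟨p, rfl⟩ := hπ v
    refine intSp_map π h0 hq hhq p ?_
    induction p using Polynomial.induction_on' with
    | add p q hp hq => exact Submodule.add_mem _ hp hq
    | monomial n a =>
      rw [← C_mul_X_pow_eq_monomial]
      refine Submodule.subset_span ⟨2 * n - (k - 1), ?_⟩
      rw [hh0, smul_eq_C_mul]
      rcases n with _ | n
      · simp; ring
      · simp; ring

open Polynomial DirectSum in
theorem jacobson_morozov [FiniteDimensional K V] (e : V →ₗ[K] V) (he : IsNilpotent e) : JM e := by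
  classical
  obtain ⟨N, hN⟩ := he
  have htor : Module.IsTorsion' (Module.AEval' e) (Submonoid.powers (X : K[X])) := by
    intro x
    refine ⟨⟨X ^ N, N, rfl⟩, ?_⟩
    change (X ^ N : K[X]) • x = 0
    have := Module.AEval'.X_pow_smul_of e ((Module.AEval'.of e).symm x) N
    rw [LinearEquiv.apply_symm_apply, hN] at this
    rw [this]; simp
  obtain ⟨d, k, ⟨φ⟩⟩ := Module.torsion_by_prime_power_decomposition
    (p := (X : K[X])) Polynomial.irreducible_X htor
  have h1 := JM.directSum (K := K) (V := fun i : Fin d => K[X] ⧸ Submodule.span K[X] {(X : K[X]) ^ k i})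
    _ (fun i => JM.quot (k i))
  let ψ : (⨁ i : Fin d, K[X] ⧸ Submodule.span K[X] {(X : K[X]) ^ k i}) ≃ₗ[K] V :=
    (φ.symm.restrictScalars K).trans (Module.AEval'.of e).symm
  refine h1.transport ψ _ _ ?_
  intro v
  have h2 : (DirectSum.lmap fun i => (LinearMap.lsmul K[X] (K[X] ⧸ Submodule.span K[X] {(X : K[X]) ^ k i}) (X : K[X])).restrictScalars K) v
    = (X : K[X]) • v := by
    ext i
    simp [DirectSum.smul_apply]
  rw [h2]
  change _ = (Module.AEval'.of e).symm (φ.symm ((X : K[X]) • v))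
  rw [map_smul, Module.AEval'.of_symm_X_smul]
  rfl

end basic
end Wz

set_option linter.unusedSectionVars false

namespace Wz

/-- A linear map satisfying the Leibniz rule. -/
def IsDer {K R : Type*} [Field K] [Ring R] [Algebra K R] (D : R →ₗ[K] R) : Prop :=
  ∀ a b, D (a * b) = D a * b + a * D b

section der
variable {K R : Type*} [Field K] [Ring R] [Algebra K R]

lemma IsDer.one {D : R →ₗ[K] R} (hD : IsDer D) : D 1 = 0 := by
  have := hD 1 1
  simpa using this

lemma IsDer.algebraMap {D : R →ₗ[K] R} (hD : IsDer D) (c : K) : D (algebraMap K R c) = 0 := by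
  rw [Algebra.algebraMap_eq_smul_one, map_smul, hD.one, smul_zero]

lemma IsDer.pow_mul_eq_zero {D : R →ₗ[K] R} (hD : IsDer D) :
    ∀ (N m n : ℕ) (a b : R), m + n = N → (D ^ m) a = 0 → (D ^ n) b = 0 → (D ^ N) (a * b) = 0 := by
  intro N
  induction N with
  | zero =>
    intro m n a b hmn ha hb
    obtain ⟨rfl, rfl⟩ : m = 0 ∧ n = 0 := by omega
    simp only [pow_zero, Module.End.one_apply] at *
    rw [ha, zero_mul]
  | succ N ih =>
    intro m n a b hmn ha hb
    rw [pow_succ, Module.End.mul_apply, hD, map_add]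
    have h1 : (D ^ N) (D a * b) = 0 := by
      rcases m with _ | m
      · simp only [pow_zero, Module.End.one_apply] at ha
        rw [ha]; simp
      · rw [pow_succ, Module.End.mul_apply] at ha
        exact ih m n _ _ (by omega) ha hb
    have h2 : (D ^ N) (a * D b) = 0 := by
      rcases n with _ | n
      · simp only [pow_zero, Module.End.one_apply] at hb
        rw [hb]; simp
      · rw [pow_succ, Module.End.mul_apply] at hb
        exact ih m n _ _ (by omega) ha hb
    rw [h1, h2, add_zero]

lemma locNil_of_adjoin {D : R →ₗ[K] R} (hD : IsDer D) (S : Set R) (hS : Algebra.adjoin K S = ⊤)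
    (h : ∀ s ∈ S, ∃ n : ℕ, (D ^ n) s = 0) : LocNil D := by
  intro v
  have hv : v ∈ Algebra.adjoin K S := by rw [hS]; trivial
  change v ∈ nilSub D
  induction hv using Algebra.adjoin_induction with
  | mem x hx => exact h x hx
  | algebraMap r => exact ⟨1, by rw [pow_one]; exact hD.algebraMap r⟩
  | add x y _ _ hx hy => exact Submodule.add_mem _ hx hy
  | mul x y _ _ hx hy =>
    obtain ⟨m, hm⟩ := hx
    obtain ⟨n, hn⟩ := hy
    exact ⟨m + n, hD.pow_mul_eq_zero _ m n x y rfl hm hn⟩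

lemma intSp_mul {D : R →ₗ[K] R} (hD : IsDer D) {a b : R} (ha : a ∈ IntSp D) (hb : b ∈ IntSp D) :
    a * b ∈ IntSp D := by
  unfold IntSp at ha hb
  induction ha using Submodule.span_induction with
  | zero => rw [zero_mul]; exact Submodule.zero_mem _
  | add x y _ _ hx hy => rw [add_mul]; exact Submodule.add_mem _ hx hy
  | smul c x _ hx => rw [smul_mul_assoc]; exact Submodule.smul_mem _ _ hx
  | mem x hx =>
    induction hb using Submodule.span_induction with
    | zero => rw [mul_zero]; exact Submodule.zero_mem _
    | add x y _ _ hx hy => rw [mul_add]; exact Submodule.add_mem _ hx hy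
    | smul c x _ hx => rw [mul_smul_comm]; exact Submodule.smul_mem _ _ hx
    | mem y hy =>
      obtain ⟨k, hk⟩ := hx
      obtain ⟨l, hl⟩ := hy
      refine Submodule.subset_span ⟨k + l, ?_⟩
      rw [hD, hk, hl, smul_mul_assoc, mul_smul_comm, ← add_smul]
      push_cast
      rfl

lemma intDiag_of_adjoin {D : R →ₗ[K] R} (hD : IsDer D) (S : Set R) (hS : Algebra.adjoin K S = ⊤)
    (h : ∀ s ∈ S, s ∈ IntSp D) : IntDiag D := by
  intro v
  have hv : v ∈ Algebra.adjoin K S := by rw [hS]; trivial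
  induction hv using Algebra.adjoin_induction with
  | mem x hx => exact h x hx
  | algebraMap r => exact Submodule.subset_span ⟨0, by rw [hD.algebraMap]; simp⟩
  | add x y _ _ hx hy => exact Submodule.add_mem _ hx hy
  | mul x y _ _ hx hy => exact intSp_mul hD hx hy

lemma der_ext {D D' : R →ₗ[K] R} (hD : IsDer D) (hD' : IsDer D') (S : Set R)
    (hS : Algebra.adjoin K S = ⊤) (h : ∀ s ∈ S, D s = D' s) (v : R) : D v = D' v := by
  have hv : v ∈ Algebra.adjoin K S := by rw [hS]; trivial
  induction hv using Algebra.adjoin_induction with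
  | mem x hx => exact h x hx
  | algebraMap r => rw [hD.algebraMap, hD'.algebraMap]
  | add x y _ _ hx hy => rw [map_add, map_add, hx, hy]
  | mul x y _ _ hx hy => rw [hD, hD', hx, hy]

lemma IsDer.comm {D D' : R →ₗ[K] R} (hD : IsDer D) (hD' : IsDer D') :
    IsDer (D ∘ₗ D' - D' ∘ₗ D) := by
  intro a b
  simp only [LinearMap.sub_apply, LinearMap.comp_apply, hD _ _, hD' _ _, map_add]
  noncomm_ring

lemma IsDer.smul {D : R →ₗ[K] R} (hD : IsDer D) (c : K) : IsDer (c • D) := by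
  intro a b
  simp [hD _ _, smul_add]

lemma sl2_of_adjoin {e f h : R →ₗ[K] R} (he : IsDer e) (hf : IsDer f) (hh : IsDer h) (S : Set R)
    (hS : Algebra.adjoin K S = ⊤)
    (h1 : ∀ v ∈ S, e (f v) - f (e v) = h v)
    (h2 : ∀ v ∈ S, h (e v) - e (h v) = (2 : K) • e v)
    (h3 : ∀ v ∈ S, h (f v) - f (h v) = -((2 : K) • f v)) : Sl2 e f h := by
  refine ⟨?_, ?_, ?_⟩
  · exact der_ext (he.comm hf) hh S hS h1
  · exact der_ext (hh.comm he) (he.smul 2) S hS h2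
  · intro v
    have := der_ext (hh.comm hf) (hf.smul (-2)) S hS (by
      intro s hs
      have := h3 s hs
      simpa using this) v
    simpa using this
end der

section sl2
variable {K V : Type*} [Field K] [AddCommGroup V] [Module K V]

lemma Sl2.h_pow {e f h : V →ₗ[K] V} (hs : Sl2 e f h) {v : V} {c : K} (hv : h v = c • v) (n : ℕ) :
    h ((f ^ n) v) = (c - 2 * n) • (f ^ n) v := by
  induction n with
  | zero => simp [hv]
  | succ n ih =>
    rw [pow_succ', Module.End.mul_apply]
    have := hs.hf ((f ^ n) v)
    rw [sub_eq_iff_eq_add] at this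
    rw [this, ih, map_smul]
    push_cast
    module

lemma Sl2.h_pow_e {e f h : V →ₗ[K] V} (hs : Sl2 e f h) {v : V} {c : K} (hv : h v = c • v) (n : ℕ) :
    h ((e ^ n) v) = (c + 2 * n) • (e ^ n) v := by
  induction n with
  | zero => simp [hv]
  | succ n ih =>
    rw [pow_succ', Module.End.mul_apply]
    have := hs.he ((e ^ n) v)
    rw [sub_eq_iff_eq_add] at this
    rw [this, ih, map_smul]
    push_cast
    module

lemma Sl2.e_pow {e f h : V →ₗ[K] V} (hs : Sl2 e f h) {v : V} {c : K} (hv : h v = c • v) (n : ℕ) :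
    e ((f ^ (n + 1)) v) = (f ^ (n + 1)) (e v) + ((n + 1) * (c - n)) • (f ^ n) v := by
  induction n with
  | zero =>
    have := hs.ef v
    rw [sub_eq_iff_eq_add] at this
    simp [this, hv, add_comm]
  | succ n ih =>
    rw [pow_succ', Module.End.mul_apply]
    have := hs.ef ((f ^ (n + 1)) v)
    rw [sub_eq_iff_eq_add] at this
    have hfn : f ((f ^ n) v) = (f ^ (n + 1)) v := by rw [pow_succ', Module.End.mul_apply]
    rw [this, ih, hs.h_pow hv, map_add, map_smul, Module.End.mul_apply, hfn]
    push_cast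
    module

/-- A highest weight vector has natural weight, if `f` is nilpotent on it. -/
lemma Sl2.hw [CharZero K] {e f h : V →ₗ[K] V} (hs : Sl2 e f h) {v : V} {c : K} (hv : h v = c • v)
    (hev : e v = 0) (hnil : ∃ n : ℕ, (f ^ n) v = 0) (h0 : v ≠ 0) :
    ∃ n : ℕ, h v = (n : K) • v ∧ (f ^ (n + 1)) v = 0 := by
  classical
  have hn := Nat.find_spec hnil
  have hm := fun m => Nat.find_min hnil (m := m)
  rcases hN : Nat.find hnil with _ | n
  · rw [hN] at hn; simp at hn; exact absurd hn h0
  · rw [hN] at hn hm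
    have h1 := hs.e_pow hv n
    rw [hn, hev, map_zero, map_zero, zero_add] at h1
    have h2 := (smul_eq_zero.1 h1.symm).resolve_right (hm n (by omega))
    have h3 : (n + 1 : K) ≠ 0 := by exact_mod_cast Nat.succ_ne_zero n
    have h4 := (mul_eq_zero.1 h2).resolve_left h3
    exact ⟨n, by rw [hv, sub_eq_zero.1 h4], hn⟩
end sl2

section reynolds
variable {K R : Type*} [Field K] [CharZero K] [Ring R] [Algebra K R]

/-- Coefficients of the extremal projector in weight zero. -/
def pc (K : Type*) [Field K] : ℕ → K
  | 0 => 1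
  | n + 1 => - pc K n / ((n + 1) * (n + 2))

/-- Truncated extremal projector. -/
def PP (e f : R →ₗ[K] R) : ℕ → (R →ₗ[K] R)
  | 0 => 0
  | n + 1 => PP e f n + pc K n • (f ^ n * e ^ n)

/-- Truncated projector to weight zero. -/
def QQ (h : R →ₗ[K] R) : ℕ → (R →ₗ[K] R)
  | 0 => 1
  | n + 1 => QQ h n * (1 - ((1 : K) / ((n + 1) ^ 2)) • (h * h))

lemma PP_e {e f h : R →ₗ[K] R} (hs : Sl2 e f h) {a : R} (ha : h a = 0) (n : ℕ) :
    e (PP e f (n + 1) a) = pc K n • (f ^ n) ((e ^ (n + 1)) a) := by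
  induction n with
  | zero => simp [PP, pc]
  | succ n ih =>
    rw [PP, LinearMap.add_apply, map_add, ih, LinearMap.smul_apply, map_smul,
      Module.End.mul_apply]
    have h1 : h ((e ^ (n + 1)) a) = (0 + 2 * ((n + 1 : ℕ) : K)) • (e ^ (n + 1)) a :=
      hs.h_pow_e (by simpa using ha) (n + 1)
    rw [hs.e_pow h1, pow_succ' e (n + 1), Module.End.mul_apply, pc, smul_add, smul_smul]
    have h3 : (n + 1 : K) ≠ 0 := by exact_mod_cast Nat.succ_ne_zero n
    have h4 : (n + 2 : K) ≠ 0 := by exact_mod_cast Nat.succ_ne_zero (n + 1)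
    have : (-pc K n / ((n + 1) * (n + 2)) * ((n + 1) * (0 + 2 * ((n + 1 : ℕ) : K) - n)))
        = - pc K n := by
      push_cast
      field_simp
      ring
    rw [this]
    module

lemma QQ_zero {h : R →ₗ[K] R} {a : R} (ha : h a = 0) (n : ℕ) : QQ h n a = a := by
  induction n with
  | zero => simp [QQ]
  | succ n ih => simp [QQ, ha, ih]

lemma QQ_eig {h : R →ₗ[K] R} {a : R} {c : K} (ha : h a = c • a) (n : ℕ) :
    ∃ b : K, QQ h n a = b • a := by
  induction n with
  | zero => exact ⟨1, by simp [QQ]⟩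
  | succ n ih =>
    obtain ⟨b, hb⟩ := ih
    refine ⟨(1 - (1 / (n + 1) ^ 2) * (c * c)) * b, ?_⟩
    simp only [QQ, Module.End.mul_apply, LinearMap.sub_apply, Module.End.one_apply,
      LinearMap.smul_apply, ha, map_smul, map_sub, hb]
    module

lemma QQ_kill {h : R →ₗ[K] R} {a : R} {k : ℤ} (hk : k ≠ 0) (ha : h a = (k : K) • a) (n : ℕ)
    (hn : k.natAbs ≤ n) : QQ h n a = 0 := by
  induction n with
  | zero => omega
  | succ n ih =>
    have h1 : QQ h (n + 1) a = (1 - (1 / (n + 1 : K) ^ 2) * (k * k)) • QQ h n a := by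
      simp only [QQ, Module.End.mul_apply, LinearMap.sub_apply, Module.End.one_apply,
        LinearMap.smul_apply, ha, map_smul, map_sub]
      module
    rw [h1]
    by_cases h2 : k.natAbs ≤ n
    · rw [ih h2, smul_zero]
    · have h3 : k.natAbs = n + 1 := by omega
      have h4 : k * k = ((n + 1 : ℕ) : ℤ) * ((n + 1 : ℕ) : ℤ) := by
        rw [← Int.natAbs_mul_self, h3]; push_cast; ring
      have h5 : (k : K) * k = (n + 1) * (n + 1) := by exact_mod_cast h4
      have h6 : (n + 1 : K) ≠ 0 := by exact_mod_cast Nat.succ_ne_zero n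
      rw [h5]
      have : (1 - (1 / (n + 1 : K) ^ 2) * ((n + 1) * (n + 1))) = 0 := by
        field_simp; ring
      rw [this, zero_smul]

/-- Truncated Reynolds operator. -/
def RR (e f h : R →ₗ[K] R) (n : ℕ) : R →ₗ[K] R := PP e f n * QQ h n

lemma RR_kill {e f h : R →ₗ[K] R} (hs : Sl2 e f h) (hn : LocNil e) (hd : IntDiag h) (a : R) :
    ∀ᶠ n in Filter.atTop, e (RR e f h n a) = 0 := by
  have ha := hd a
  unfold IntSp at ha
  induction ha using Submodule.span_induction with
  | zero => simp
  | add x y _ _ hx hy =>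
    filter_upwards [hx, hy] with n hx hy
    rw [map_add, map_add, hx, hy, add_zero]
  | smul c x _ hx =>
    filter_upwards [hx] with n hx
    rw [map_smul, map_smul, hx, smul_zero]
  | mem x hx =>
    obtain ⟨k, hk⟩ := hx
    by_cases h0 : k = 0
    · subst h0
      have hx0 : h x = 0 := by simpa using hk
      obtain ⟨N, hN⟩ := hn x
      filter_upwards [Filter.eventually_ge_atTop (N + 1)] with n hn'
      obtain ⟨m, rfl⟩ : ∃ m, n = m + 1 := ⟨n - 1, by omega⟩
      rw [RR, Module.End.mul_apply, QQ_zero hx0, PP_e hs hx0]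
      obtain ⟨j, hj⟩ : ∃ j, m + 1 = j + N := ⟨m + 1 - N, by omega⟩
      rw [hj, pow_add, Module.End.mul_apply, hN]
      simp
    · filter_upwards [Filter.eventually_ge_atTop k.natAbs] with n hn'
      rw [RR, Module.End.mul_apply, QQ_kill h0 hk n hn', map_zero, map_zero]

lemma pow_mul_const {D : R →ₗ[K] R} (hD : IsDer D) {m : R} (hm : D m = 0) (a : R) (n : ℕ) :
    (D ^ n) (a * m) = (D ^ n) a * m := by
  induction n generalizing a with
  | zero => simp
  | succ n ih => rw [pow_succ, Module.End.mul_apply, hD, hm, mul_zero, add_zero, ih,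
      Module.End.mul_apply]

lemma QQ_mul {h : R →ₗ[K] R} (hh : IsDer h) {m : R} (hm : h m = 0) (a : R) (n : ℕ) :
    QQ h n (a * m) = QQ h n a * m := by
  induction n generalizing a with
  | zero => simp [QQ]
  | succ n ih =>
    simp only [QQ, Module.End.mul_apply, LinearMap.sub_apply, Module.End.one_apply,
      LinearMap.smul_apply]
    rw [← ih]
    congr 1
    rw [hh, hm, mul_zero, add_zero, hh, hm, mul_zero, add_zero, sub_mul, smul_mul_assoc]

lemma PP_mul {e f : R →ₗ[K] R} (he : IsDer e) (hf : IsDer f) {m : R} (hm : e m = 0) (hm' : f m = 0)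
    (a : R) (n : ℕ) : PP e f n (a * m) = PP e f n a * m := by
  induction n with
  | zero => simp [PP]
  | succ n ih =>
    simp only [PP, LinearMap.add_apply, LinearMap.smul_apply, Module.End.mul_apply]
    rw [ih, pow_mul_const he hm, pow_mul_const hf hm', add_mul, smul_mul_assoc]

lemma RR_mul {e f h : R →ₗ[K] R} (he : IsDer e) (hf : IsDer f) (hh : IsDer h) {m : R}
    (hm : e m = 0) (hm' : f m = 0) (hm'' : h m = 0) (a : R) (n : ℕ) :
    RR e f h n (a * m) = RR e f h n a * m := by
  rw [RR, Module.End.mul_apply, Module.End.mul_apply, QQ_mul hh hm'', PP_mul he hf hm hm']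

lemma PP_fix {e f : R →ₗ[K] R} {m : R} (hm : e m = 0) (n : ℕ) : PP e f (n + 1) m = m := by
  induction n with
  | zero => simp [PP, pc]
  | succ n ih =>
    rw [PP, LinearMap.add_apply, ih, LinearMap.smul_apply, Module.End.mul_apply, pow_succ,
      pow_succ, Module.End.mul_apply (e ^ n), hm]
    simp

lemma RR_fix {e f h : R →ₗ[K] R} {m : R}
    (hm : e m = 0) (hm'' : h m = 0) (n : ℕ) :
    RR e f h (n + 1) m = m := by
  rw [RR, Module.End.mul_apply, QQ_zero hm'', PP_fix hm]

end reynolds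
end Wz

set_option linter.unusedSectionVars false

namespace Wz
open MvPolynomial TensorProduct

section S
variable (K : Type*) [Field K]

/-- `y ∂_x`. -/
def eS : MvPolynomial (Fin 2) K →ₗ[K] MvPolynomial (Fin 2) K :=
  LinearMap.mulLeft K (X 1) ∘ₗ (pderiv 0).toLinearMap
/-- `x ∂_y`. -/
def fS : MvPolynomial (Fin 2) K →ₗ[K] MvPolynomial (Fin 2) K :=
  LinearMap.mulLeft K (X 0) ∘ₗ (pderiv 1).toLinearMap
/-- `y ∂_y - x ∂_x`. -/
def hS : MvPolynomial (Fin 2) K →ₗ[K] MvPolynomial (Fin 2) K :=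
  LinearMap.mulLeft K (X 1) ∘ₗ (pderiv 1).toLinearMap
    - LinearMap.mulLeft K (X 0) ∘ₗ (pderiv 0).toLinearMap

lemma eS_apply (p) : eS K p = X 1 * pderiv 0 p := rfl
lemma fS_apply (p) : fS K p = X 0 * pderiv 1 p := rfl
lemma hS_apply (p) : hS K p = X 1 * pderiv 1 p - X 0 * pderiv 0 p := rfl

lemma eS_der : IsDer (eS K) := by
  intro a b; simp only [eS_apply, Derivation.leibniz, smul_eq_mul]; ring
lemma fS_der : IsDer (fS K) := by
  intro a b; simp only [fS_apply, Derivation.leibniz, smul_eq_mul]; ring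
lemma hS_der : IsDer (hS K) := by
  intro a b; simp only [hS_apply, Derivation.leibniz, smul_eq_mul]; ring

lemma adj_S : Algebra.adjoin K (Set.range (X : Fin 2 → MvPolynomial (Fin 2) K)) = ⊤ :=
  MvPolynomial.adjoin_range_X

lemma sl2_S : Sl2 (eS K) (fS K) (hS K) := by
  refine sl2_of_adjoin (eS_der K) (fS_der K) (hS_der K) _ (adj_S K) ?_ ?_ ?_ <;>
  · rintro _ ⟨i, rfl⟩
    fin_cases i <;>
    simp [eS_apply, fS_apply, hS_apply, pderiv_X, two_smul] <;> ring

lemma nil_eS : LocNil (eS K) := by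
  refine locNil_of_adjoin (eS_der K) _ (adj_S K) ?_
  rintro _ ⟨i, rfl⟩
  refine ⟨2, ?_⟩
  rw [pow_two, Module.End.mul_apply]
  fin_cases i <;> simp [eS_apply, pderiv_X]

lemma diag_hS : IntDiag (hS K) := by
  refine intDiag_of_adjoin (hS_der K) _ (adj_S K) ?_
  rintro _ ⟨i, rfl⟩
  fin_cases i
  · exact Submodule.subset_span ⟨-1, by simp [hS_apply, pderiv_X]⟩
  · exact Submodule.subset_span ⟨1, by simp [hS_apply, pderiv_X]⟩

lemma eS_mon (a b : ℕ) : eS K (X 0 ^ a * X 1 ^ b) = (a : K) • (X 0 ^ (a - 1) * X 1 ^ (b + 1)) := by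
  rw [eS_apply, Derivation.leibniz, Derivation.leibniz_pow, Derivation.leibniz_pow]
  simp [pderiv_X, smul_eq_C_mul]
  ring

lemma fS_mon (a b : ℕ) : fS K (X 0 ^ a * X 1 ^ b) = (b : K) • (X 0 ^ (a + 1) * X 1 ^ (b - 1)) := by
  rw [fS_apply, Derivation.leibniz, Derivation.leibniz_pow, Derivation.leibniz_pow]
  simp [pderiv_X, smul_eq_C_mul]
  ring

lemma hS_mon (a b : ℕ) : hS K (X 0 ^ a * X 1 ^ b) = ((b : K) - a) • (X 0 ^ a * X 1 ^ b) := by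
  rw [hS_apply, Derivation.leibniz, Derivation.leibniz_pow, Derivation.leibniz_pow,
    Derivation.leibniz, Derivation.leibniz_pow, Derivation.leibniz_pow]
  rcases a with _ | a <;> rcases b with _ | b <;>
  simp [pderiv_X, smul_eq_C_mul] <;> ring
end S

section T
variable {K T : Type*} [Field K] [CharZero K] [CommRing T] [Algebra K T]

/-- The tensor product derivation. -/
def tD (a : T →ₗ[K] T) (b : MvPolynomial (Fin 2) K →ₗ[K] MvPolynomial (Fin 2) K) :
    (T ⊗[K] MvPolynomial (Fin 2) K) →ₗ[K] (T ⊗[K] MvPolynomial (Fin 2) K) :=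
  TensorProduct.map a LinearMap.id + TensorProduct.map LinearMap.id b

lemma tD_tmul (a : T →ₗ[K] T) (b : MvPolynomial (Fin 2) K →ₗ[K] MvPolynomial (Fin 2) K) (t s) :
    tD a b (t ⊗ₜ s) = a t ⊗ₜ s + t ⊗ₜ b s := by simp [tD]

lemma tD_der {a : T →ₗ[K] T} {b : MvPolynomial (Fin 2) K →ₗ[K] MvPolynomial (Fin 2) K}
    (ha : IsDer a) (hb : IsDer b) : IsDer (tD a b) := by
  intro x y
  induction x using TensorProduct.induction_on with
  | zero => simp
  | add x x' hx hx' => rw [add_mul, map_add, hx, hx', map_add]; ring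
  | tmul t s =>
    induction y using TensorProduct.induction_on with
    | zero => simp
    | add x x' hx hx' => rw [mul_add, map_add, hx, hx', map_add]; ring
    | tmul t' s' =>
      rw [Algebra.TensorProduct.tmul_mul_tmul, tD_tmul, tD_tmul, tD_tmul, ha, hb, add_mul, mul_add,
        Algebra.TensorProduct.tmul_mul_tmul, Algebra.TensorProduct.tmul_mul_tmul,
        Algebra.TensorProduct.tmul_mul_tmul, Algebra.TensorProduct.tmul_mul_tmul,
        TensorProduct.add_tmul, TensorProduct.tmul_add]
      abel

lemma tD_sl2 {e f h : T →ₗ[K] T} (hs : Sl2 e f h) :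
    Sl2 (tD e (eS K)) (tD f (fS K)) (tD h (hS K)) := by
  have hs' := sl2_S K
  refine ⟨?_, ?_, ?_⟩
  · intro x
    induction x using TensorProduct.induction_on with
    | zero => simp
    | add x x' hx hx' => rw [map_add (tD h (hS K)), ← hx, ← hx']; simp only [map_add]; abel
    | tmul t s =>
      simp only [tD_tmul, map_add, ← hs.ef, ← hs'.ef, TensorProduct.sub_tmul,
        TensorProduct.tmul_sub]
      abel
  · intro x
    induction x using TensorProduct.induction_on with
    | zero => simp
    | add x x' hx hx' => rw [map_add (tD e (eS K)), smul_add, ← hx, ← hx']; simp only [map_add]; abel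
    | tmul t s =>
      simp only [tD_tmul, map_add, smul_add]
      rw [TensorProduct.smul_tmul', ← TensorProduct.tmul_smul, ← hs.he, ← hs'.he, TensorProduct.sub_tmul,
        TensorProduct.tmul_sub]
      abel
  · intro x
    induction x using TensorProduct.induction_on with
    | zero => simp
    | add x x' hx hx' =>
      rw [map_add (tD f (fS K)), smul_add, neg_add, ← hx, ← hx']; simp only [map_add]; abel
    | tmul t s =>
      simp only [tD_tmul, map_add, smul_add, neg_add]
      rw [TensorProduct.smul_tmul', ← TensorProduct.tmul_smul, ← TensorProduct.neg_tmul,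
        ← TensorProduct.tmul_neg, ← hs.hf, ← hs'.hf, TensorProduct.sub_tmul,
        TensorProduct.tmul_sub]
      abel

lemma adj_tensor : Algebra.adjoin K (Set.range (fun t : T => t ⊗ₜ[K] (1 : MvPolynomial (Fin 2) K)) ∪
    Set.range (fun s : MvPolynomial (Fin 2) K => (1 : T) ⊗ₜ[K] s)) = ⊤ := by
  rw [eq_top_iff]
  intro x _
  induction x using TensorProduct.induction_on with
  | zero => exact Subalgebra.zero_mem _
  | add x x' hx hx' => exact Subalgebra.add_mem _ (hx trivial) (hx' trivial)
  | tmul t s =>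
    have : t ⊗ₜ[K] s = (t ⊗ₜ[K] 1) * (1 ⊗ₜ[K] s) := by simp
    rw [this]
    exact Subalgebra.mul_mem _ (Algebra.subset_adjoin (Or.inl ⟨t, rfl⟩))
      (Algebra.subset_adjoin (Or.inr ⟨s, rfl⟩))

lemma tD_left {a : T →ₗ[K] T} {b : MvPolynomial (Fin 2) K →ₗ[K] MvPolynomial (Fin 2) K}
    (hb : IsDer b) (t : T) : tD a b ((TensorProduct.mk K T (MvPolynomial (Fin 2) K)).flip 1 t) =
      (TensorProduct.mk K T (MvPolynomial (Fin 2) K)).flip 1 (a t) := by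
  simp [tD_tmul, hb.one]

lemma tD_right {a : T →ₗ[K] T} {b : MvPolynomial (Fin 2) K →ₗ[K] MvPolynomial (Fin 2) K}
    (ha : IsDer a) (s) : tD a b (TensorProduct.mk K T (MvPolynomial (Fin 2) K) 1 s) =
      TensorProduct.mk K T (MvPolynomial (Fin 2) K) 1 (b s) := by
  simp [tD_tmul, ha.one]

lemma tD_nil {e : T →ₗ[K] T} (he : IsDer e) (hn : LocNil e) : LocNil (tD e (eS K)) := by
  refine locNil_of_adjoin (tD_der he (eS_der K)) _ adj_tensor ?_
  rintro _ (⟨t, rfl⟩ | ⟨s, rfl⟩)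
  · obtain ⟨n, hn⟩ := hn t
    refine ⟨n, ?_⟩
    have := pow_intertwine ((TensorProduct.mk K T (MvPolynomial (Fin 2) K)).flip 1) e
      (tD e (eS K)) (tD_left (eS_der K)) n t
    rw [hn, map_zero] at this
    exact this
  · obtain ⟨n, hn⟩ := nil_eS K s
    refine ⟨n, ?_⟩
    have := pow_intertwine (TensorProduct.mk K T (MvPolynomial (Fin 2) K) 1) (eS K)
      (tD e (eS K)) (tD_right he) n s
    rw [hn, map_zero] at this
    exact this

lemma tD_diag {h : T →ₗ[K] T} (hh : IsDer h) (hd : IntDiag h) : IntDiag (tD h (hS K)) := by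
  refine intDiag_of_adjoin (tD_der hh (hS_der K)) _ adj_tensor ?_
  rintro _ (⟨t, rfl⟩ | ⟨s, rfl⟩)
  · exact intSp_map ((TensorProduct.mk K T (MvPolynomial (Fin 2) K)).flip 1) h
      (tD h (hS K)) (tD_left (hS_der K)) t (hd t)
  · exact intSp_map (TensorProduct.mk K T (MvPolynomial (Fin 2) K) 1) (hS K)
      (tD h (hS K)) (tD_right hh) s (diag_hS K s)

/-- Evaluation at `x = 1`, `y = 0`. -/
def evT (K T : Type*) [Field K] [CommRing T] [Algebra K T] :
    (T ⊗[K] MvPolynomial (Fin 2) K) →ₐ[K] T :=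
  Algebra.TensorProduct.lift (AlgHom.id K T)
    ((Algebra.ofId K T).comp (aeval (fun i : Fin 2 => if i = 0 then (1 : K) else 0)))
    (fun _ _ => Commute.all _ _)

lemma evT_tmul (t : T) (s : MvPolynomial (Fin 2) K) :
    evT K T (t ⊗ₜ s) = t * algebraMap K T (aeval (fun i : Fin 2 => if i = 0 then (1 : K) else 0) s) := by
  rw [evT, Algebra.TensorProduct.lift_tmul]; rfl

lemma evT_e {e : T →ₗ[K] T} (he : IsDer e) (x : T ⊗[K] MvPolynomial (Fin 2) K) :
    evT K T (tD e (eS K) x) = e (evT K T x) := by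
  induction x using TensorProduct.induction_on with
  | zero => simp
  | add x x' hx hx' => simp only [map_add, hx, hx']
  | tmul t s =>
    rw [tD_tmul, map_add, evT_tmul, evT_tmul, evT_tmul, he, he.algebraMap, eS_apply, map_mul,
      aeval_X]
    simp

/-- Coefficients `(-1)^i / i!`. -/
def cc (K : Type*) [Field K] : ℕ → K
  | 0 => 1
  | n + 1 => - cc K n / (n + 1)

/-- A term of the invariant attached to a highest weight vector. -/
def tm (f : T →ₗ[K] T) (w : T) (n i : ℕ) : T ⊗[K] MvPolynomial (Fin 2) K :=
  cc K i • ((f ^ i) w ⊗ₜ (X 0 ^ (n - i) * X 1 ^ i))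

/-- The invariant attached to a highest weight vector. -/
def til (f : T →ₗ[K] T) (w : T) (n : ℕ) : T ⊗[K] MvPolynomial (Fin 2) K :=
  ∑ i ∈ Finset.range (n + 1), tm f w n i

lemma cc_succ (i : ℕ) : cc K (i + 1) * (i + 1) = - cc K i := by
  have h3 : (i + 1 : K) ≠ 0 := by exact_mod_cast Nat.succ_ne_zero i
  rw [cc]; field_simp

lemma til_e {e f h : T →ₗ[K] T} (hs : Sl2 e f h) {w : T} {n : ℕ} (hw : h w = (n : K) • w)
    (hew : e w = 0) : tD e (eS K) (til f w n) = 0 := by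
  have key : ∀ m ≤ n, tD e (eS K) (∑ i ∈ Finset.range (m + 1), tm f w n i)
      = (((n : K) - m) * cc K m) • ((f ^ m) w ⊗ₜ (X 0 ^ (n - m - 1) * X 1 ^ (m + 1))) := by
    intro m
    induction m with
    | zero =>
      intro _
      have h0 := eS_mon K n 0
      simp only [pow_zero, mul_one, zero_add, pow_one] at h0
      simp [tm, tD_tmul, hew, h0, smul_smul, mul_comm]
    | succ m ih =>
      intro hm
      rw [Finset.sum_range_succ, map_add, ih (by omega)]
      simp only [tm, map_smul, tD_tmul, eS_mon, hs.e_pow hw, hew, map_zero, zero_add,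
        TensorProduct.tmul_smul, ← TensorProduct.smul_tmul', smul_add, smul_smul]
      have h1 : cc K (m + 1) * ((m + 1) * (n - m)) = - ((n - m) * cc K m) := by
        linear_combination (n - m : K) * cc_succ (K := K) m
      rw [h1, show n - (m + 1) = n - m - 1 from rfl]
      have h2 : ((n - m - 1 : ℕ) : K) = n - (m + 1 : ℕ) := by
        rw [Nat.sub_sub, Nat.cast_sub hm]
      rw [h2]
      module
  rw [til, key n le_rfl]
  simp

lemma til_f {f : T →ₗ[K] T} {w : T} {n : ℕ}
    (hfw : (f ^ (n + 1)) w = 0) : tD f (fS K) (til f w n) = 0 := by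
  have key : ∀ m ≤ n, tD f (fS K) (∑ i ∈ Finset.range (m + 1), tm f w n i)
      = cc K m • ((f ^ (m + 1)) w ⊗ₜ (X 0 ^ (n - m) * X 1 ^ m)) := by
    intro m
    induction m with
    | zero =>
      intro _
      have h0 := fS_mon K n 0
      simp only [pow_zero, mul_one, zero_add, pow_one, Nat.cast_zero, zero_smul] at h0
      simp [tm, tD_tmul, h0]
    | succ m ih =>
      intro hm
      have h0 : f ((f ^ (m + 1)) w) = (f ^ (m + 1 + 1)) w := by
        rw [pow_succ' f (m + 1), Module.End.mul_apply]
      rw [Finset.sum_range_succ, map_add, ih (by omega)]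
      simp only [tm, map_smul, tD_tmul, fS_mon, h0,
        TensorProduct.tmul_smul, smul_add, smul_smul]
      have h1 : cc K (m + 1) * ((m + 1 : ℕ) : K) = - cc K m := by
        rw [← cc_succ]; push_cast; ring
      rw [h1, show n - (m + 1) + 1 = n - m by omega, show m + 1 - 1 = m from rfl]
      module
  rw [til, key n le_rfl, hfw]
  simp

lemma til_h {e f h : T →ₗ[K] T} (hs : Sl2 e f h) {w : T} {n : ℕ} (hw : h w = (n : K) • w) :
    tD h (hS K) (til f w n) = 0 := by
  rw [til, map_sum]
  refine Finset.sum_eq_zero fun i hi => ?_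
  have hi' : i ≤ n := by simpa [Nat.lt_succ_iff] using hi
  rw [tm, map_smul, tD_tmul, hS_mon, hs.h_pow hw, TensorProduct.tmul_smul,
    ← TensorProduct.smul_tmul', ← add_smul, Nat.cast_sub hi']
  have : ((n : K) - 2 * i + (i - (n - i))) = 0 := by ring
  rw [this, zero_smul, smul_zero]

lemma til_ev (f : T →ₗ[K] T) (w : T) (n : ℕ) : evT K T (til f w n) = w := by
  rw [til, map_sum, Finset.sum_range_succ', Finset.sum_eq_zero]
  · simp [tm, evT_tmul, cc]
  · intro i _
    simp [tm, evT_tmul]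

/-- The Hilbert type finiteness theorem. -/
theorem hilbert [IsNoetherianRing T] {e f h : T →ₗ[K] T} (he : IsDer e) (hf : IsDer f)
    (hh : IsDer h) (hs : Sl2 e f h) (hn : LocNil e) (hd : IntDiag h) (W : Set T)
    (hW : ∀ w ∈ W, e w = 0 ∧ ∃ n : ℕ, h w = (n : K) • w ∧ (f ^ (n + 1)) w = 0) :
    ∃ s : Finset T, (s : Set T) ⊆ W ∧ ∀ w ∈ W, ∃ c : T → T, (∀ t, e (c t) = 0) ∧
      w = ∑ t ∈ s, c t * t := by
  classical
  have : IsNoetherianRing (T ⊗[K] MvPolynomial (Fin 2) K) :=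
    Algebra.FiniteType.isNoetherianRing T _
  choose hW1 n hW2 hW3 using hW
  let τ : T → T ⊗[K] MvPolynomial (Fin 2) K := fun w =>
    if hw : w ∈ W then til f w (n w hw) else 0
  have hτ : ∀ w (hw : w ∈ W), τ w = til f w (n w hw) := fun w hw => by simp [τ, hw]
  have τe : ∀ w ∈ W, tD e (eS K) (τ w) = 0 := fun w hw => by
    rw [hτ w hw]; exact til_e hs (hW2 w hw) (hW1 w hw)
  have τf : ∀ w ∈ W, tD f (fS K) (τ w) = 0 := fun w hw => by
    rw [hτ w hw]; exact til_f (hW3 w hw)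
  have τh : ∀ w ∈ W, tD h (hS K) (τ w) = 0 := fun w hw => by
    rw [hτ w hw]; exact til_h hs (hW2 w hw)
  have τv : ∀ w ∈ W, evT K T (τ w) = w := fun w hw => by
    rw [hτ w hw]; exact til_ev f w _
  obtain ⟨s', hs', hspan⟩ := (Submodule.fg_span_iff_fg_span_finset_subset (R := T ⊗[K] MvPolynomial (Fin 2) K) (τ '' W)).1
    (IsNoetherian.noetherian _)
  obtain ⟨s, hsW, rfl⟩ := (Finset.subset_set_image_iff).1 hs'
  refine ⟨s, hsW, fun w hw => ?_⟩
  have hmem : τ w ∈ Submodule.span (T ⊗[K] MvPolynomial (Fin 2) K) (τ '' (s : Set T)) := by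
    rw [← Finset.coe_image, ← hspan]
    exact Submodule.subset_span ⟨w, hw, rfl⟩
  obtain ⟨c, hc⟩ : ∃ c : T → T ⊗[K] MvPolynomial (Fin 2) K, ∑ t ∈ s, c t • τ t = τ w := by
    obtain ⟨c, hc⟩ := (Submodule.mem_span_image_finset_iff_exists_fun _).1 hmem
    refine ⟨fun t => if ht : t ∈ s then c ⟨t, ht⟩ else 0, ?_⟩
    rw [← hc, ← Finset.sum_coe_sort s]
    exact Finset.sum_congr rfl fun t _ => by simp
  have hev : ∀ᶠ N in Filter.atTop, ∀ t ∈ s, tD e (eS K) (RR (tD e (eS K)) (tD f (fS K)) (tD h (hS K)) N (c t)) = 0 := by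
    rw [Filter.eventually_all_finset]
    intro t _
    exact RR_kill (tD_sl2 hs) (tD_nil he hn) (tD_diag hh hd) _
  obtain ⟨N, hN, hN1⟩ := (hev.and (Filter.eventually_ge_atTop 1)).exists
  obtain ⟨M, rfl⟩ : ∃ M, N = M + 1 := ⟨N - 1, by omega⟩
  set R := RR (tD e (eS K)) (tD f (fS K)) (tD h (hS K)) (M + 1) with hR
  refine ⟨fun t => if t ∈ s then evT K T (R (c t)) else 0, ?_, ?_⟩
  · intro t
    dsimp only
    split_ifs with ht
    · rw [← evT_e he, hN t ht, map_zero]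
    · simp
  · have h1 : R (τ w) = τ w := RR_fix (τe w hw) (τh w hw) M
    rw [← hc, map_sum] at h1
    have h2 : τ w = ∑ t ∈ s, R (c t) * τ t := by
      rw [← hc, ← h1]
      refine Finset.sum_congr rfl fun t ht => ?_
      exact RR_mul (tD_der he (eS_der K)) (tD_der hf (fS_der K)) (tD_der hh (hS_der K))
        (τe t (hsW ht)) (τf t (hsW ht)) (τh t (hsW ht)) _ _
    have h3 := congrArg (evT K T) h2
    rw [τv w hw, map_sum] at h3
    rw [h3]
    refine Finset.sum_congr rfl fun t ht => ?_
    rw [map_mul, τv t (hsW ht)]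
    simp only [if_pos ht]
end T
end Wz

namespace Wz
set_option linter.unusedSectionVars false
set_option linter.style.haveILetI false
section inv
variable {K V : Type*} [Field K] [AddCommGroup V] [Module K V]

lemma comp_mem [CharZero K] (h : V →ₗ[K] V) (p : Submodule K V) (hp : ∀ v ∈ p, h v ∈ p)
    (I : Finset ℤ) : ∀ (g : ℤ → V), (∀ k, h (g k) = (k : K) • g k) → ∑ k ∈ I, g k ∈ p →
      ∀ k ∈ I, g k ∈ p := by
  classical
  induction I using Finset.induction_on with
  | empty => intro g _ _ k hk; simp at hk
  | insert a I ha ih =>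
    intro g hg hs
    have key : ∀ k ∈ I, g k ∈ p := by
      have h1 : ∑ k ∈ I, ((k : K) - a) • g k ∈ p := by
        have h2 := p.sub_mem (hp _ hs) (p.smul_mem (a : K) hs)
        have h3 : h (∑ k ∈ insert a I, g k) - (a : K) • ∑ k ∈ insert a I, g k
            = ∑ k ∈ I, ((k : K) - a) • g k := by
          rw [map_sum, Finset.smul_sum, ← Finset.sum_sub_distrib, Finset.sum_insert ha]
          simp [hg, sub_smul]
        rwa [h3] at h2
      intro k hk
      have h4 := ih (fun k => ((k : K) - a) • g k)
        (fun k => by rw [map_smul, hg, smul_comm]) h1 k hk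
      have hne : (k : K) - a ≠ 0 := by
        rw [sub_ne_zero]
        intro h5
        have : k = a := by exact_mod_cast h5
        exact ha (this ▸ hk)
      have h6 := p.smul_mem ((k : K) - a)⁻¹ h4
      rwa [inv_smul_smul₀ hne] at h6
    intro k hk
    rcases Finset.mem_insert.1 hk with rfl | hk
    · rw [Finset.sum_insert ha] at hs
      exact (Submodule.add_mem_iff_left p (p.sum_mem key)).1 hs
    · exact key k hk

lemma decomp [CharZero K] (h : V →ₗ[K] V) (p : Submodule K V) (hp : ∀ v ∈ p, h v ∈ p)
    (v : V) (hv : v ∈ p) (hd : v ∈ IntSp h) :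
    ∃ (I : Finset ℤ) (g : ℤ → V), (∀ k, h (g k) = (k : K) • g k) ∧ (∀ k ∈ I, g k ∈ p) ∧
      v = ∑ k ∈ I, g k := by
  have hle : IntSp h ≤ ⨆ k : ℤ, Module.End.eigenspace h (k : K) := by
    refine Submodule.span_le.2 ?_
    rintro x ⟨k, hk⟩
    exact Submodule.mem_iSup_of_mem (p := fun k : ℤ => Module.End.eigenspace h (k : K)) k
      (Module.End.mem_eigenspace_iff.2 hk)
  obtain ⟨g, hg, hs⟩ := (Submodule.mem_iSup_iff_exists_finsupp _ _).1 (hle hd)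
  have hg' : ∀ k, h (g k) = (k : K) • g k := fun k => Module.End.mem_eigenspace_iff.1 (hg k)
  refine ⟨g.support, g, hg', ?_, hs.symm⟩
  apply comp_mem h p hp _ _ hg'
  have : ∑ k ∈ g.support, g k = v := hs
  rwa [this]
end inv

section TT
variable {K A M : Type*} [Field K] [CharZero K] [CommRing A] [Algebra K A] [AddCommGroup M]
  [Module K M] [Module A M] [IsScalarTower K A M]

/-- Pairing of operators on the two components of a trivial square-zero extension. -/
def prodOp (E : A →ₗ[K] A) (e : M →ₗ[K] M) : TrivSqZeroExt A M →ₗ[K] TrivSqZeroExt A M where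
  toFun x := (E x.fst, e x.snd)
  map_add' x y := Prod.ext (map_add E _ _) (map_add e _ _)
  map_smul' c x := Prod.ext (map_smul E _ _) (map_smul e _ _)

@[simp] lemma prodOp_fst (E : A →ₗ[K] A) (e : M →ₗ[K] M) (x : TrivSqZeroExt A M) :
    (prodOp E e x).fst = E x.fst := rfl
@[simp] lemma prodOp_snd (E : A →ₗ[K] A) (e : M →ₗ[K] M) (x : TrivSqZeroExt A M) :
    (prodOp E e x).snd = e x.snd := rfl

lemma prodOp_pow (E : A →ₗ[K] A) (e : M →ₗ[K] M) (n : ℕ) :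
    (prodOp E e) ^ n = prodOp (E ^ n) (e ^ n) := by
  induction n with
  | zero => ext x <;> simp
  | succ n ih => 
    rw [pow_succ, ih]
    ext x <;> simp [pow_succ]

lemma prodOp_sl2 {E F H : A →ₗ[K] A} {e f h : M →ₗ[K] M} (h1 : Sl2 E F H) (h2 : Sl2 e f h) :
    Sl2 (prodOp E e) (prodOp F f) (prodOp H h) where
  ef v := by ext <;> simp [h1.ef, h2.ef]
  he v := by ext <;> simp [h1.he, h2.he]
  hf v := by ext <;> simp [h1.hf, h2.hf]

lemma prodOp_nil {E : A →ₗ[K] A} {e : M →ₗ[K] M} (h1 : LocNil E) (h2 : LocNil e) :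
    LocNil (prodOp E e) := by
  intro v
  obtain ⟨n, hn⟩ := h1 v.fst
  obtain ⟨m, hm⟩ := h2 v.snd
  refine ⟨n + m, ?_⟩
  rw [prodOp_pow]
  ext
  · rw [prodOp_fst, add_comm, pow_add, Module.End.mul_apply, hn]; simp
  · rw [prodOp_snd, pow_add, Module.End.mul_apply, hm]; simp

lemma prodOp_diag {E : A →ₗ[K] A} {e : M →ₗ[K] M} (h1 : IntDiag E) (h2 : IntDiag e) :
    IntDiag (prodOp E e) := by
  intro v
  have a1 := intSp_map (⟨⟨fun a => TrivSqZeroExt.inl a, fun a b => by ext <;> simp⟩,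
    fun a b => by ext <;> simp⟩ : A →ₗ[K] TrivSqZeroExt A M) E (prodOp E e)
    (fun v => by ext <;> simp) v.fst (h1 _)
  have a2 := intSp_map (⟨⟨fun a => TrivSqZeroExt.inr a, fun a b => by ext <;> simp⟩,
    fun a b => by ext <;> simp⟩ : M →ₗ[K] TrivSqZeroExt A M) e (prodOp E e)
    (fun v => by ext <;> simp) v.snd (h2 _)
  have := Submodule.add_mem _ a1 a2
  rw [show v = TrivSqZeroExt.inl v.fst + TrivSqZeroExt.inr v.snd by ext <;> simp]
  exact this

variable [Module Aᵐᵒᵖ M] [IsCentralScalar A M]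

lemma prodOp_der {E : A →ₗ[K] A} {e : M →ₗ[K] M} (hE : IsDer E)
    (he : ∀ (a : A) (m : M), e (a • m) = E a • m + a • e m) [IsScalarTower K Aᵐᵒᵖ M] :
    IsDer (R := TrivSqZeroExt A M) (prodOp E e) := by
  intro a b
  ext
  · simp [hE _ _]
  · simp [he, op_smul_eq_smul]
    abel

lemma tsz_noeth [IsNoetherianRing A] [Module.Finite A M] :
    IsNoetherianRing (TrivSqZeroExt A M) := by
  have : IsNoetherian A (A × M) := inferInstance
  have : IsNoetherian A (TrivSqZeroExt A M) := this
  exact isNoetherian_of_tower A this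

theorem abstract_fg0 [IsScalarTower K Aᵐᵒᵖ M] [IsNoetherianRing A] [Module.Finite A M]
    {E F H : A →ₗ[K] A} {e f h : M →ₗ[K] M} (hE : IsDer E) (hF : IsDer F) (hH : IsDer H)
    (he : ∀ (a : A) (m : M), e (a • m) = E a • m + a • e m)
    (hf : ∀ (a : A) (m : M), f (a • m) = F a • m + a • f m)
    (hh : ∀ (a : A) (m : M), h (a • m) = H a • m + a • h m)
    (sA : Sl2 E F H) (sM : Sl2 e f h) (nA : LocNil E) (nM : LocNil e) (dA : IntDiag H)
    (dM : IntDiag h) (nf : LocNil f) :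
    ∃ s : Finset M, (∀ t ∈ s, e t = 0) ∧ ∀ w, e w = 0 → ∃ c : M → A, (∀ t, E (c t) = 0) ∧
      w = ∑ t ∈ s, c t • t := by
  classical
  have := tsz_noeth (A := A) (M := M)
  set W0 : Set M := {w | e w = 0 ∧ ∃ n : ℕ, h w = (n : K) • w ∧ (f ^ (n + 1)) w = 0}
  obtain ⟨s, hsW, hs⟩ := hilbert (T := TrivSqZeroExt A M) (prodOp_der hE he) (prodOp_der hF hf)
    (prodOp_der hH hh) (prodOp_sl2 sA sM) (prodOp_nil nA nM) (prodOp_diag dA dM)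
    (TrivSqZeroExt.inr '' W0) (by
      rintro _ ⟨w, ⟨h1, n, h2, h3⟩, rfl⟩
      refine ⟨by ext <;> simp [h1], n, by ext <;> simp [h2], ?_⟩
      rw [prodOp_pow]
      ext <;> simp [h3])
  obtain ⟨s', hs'W, rfl⟩ := Finset.subset_set_image_iff.1 hsW
  refine ⟨s', fun t ht => (hs'W ht).1, ?_⟩
  have key : ∀ w ∈ W0, ∃ c : M → A, (∀ t, E (c t) = 0) ∧ w = ∑ t ∈ s', c t • t := by
    intro w hw
    obtain ⟨c, hc, hcw⟩ := hs _ ⟨w, hw, rfl⟩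
    refine ⟨fun t => (c (TrivSqZeroExt.inr t)).fst, fun t => ?_, ?_⟩
    · have := congrArg TrivSqZeroExt.fst (hc (TrivSqZeroExt.inr t))
      simpa using this
    · rw [Finset.sum_image (fun a _ b _ hab => TrivSqZeroExt.inr_injective hab)] at hcw
      have := congrArg TrivSqZeroExt.snd hcw
      simpa [TrivSqZeroExt.snd_sum] using this
  have h0 : ∃ c : M → A, (∀ t, E (c t) = 0) ∧ (0 : M) = ∑ t ∈ s', c t • t :=
    ⟨fun _ => 0, by simp, by simp⟩
  intro w hw
  obtain ⟨I, g, hg, hgp, rfl⟩ := decomp h (LinearMap.ker e) (fun v hv => by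
    rw [LinearMap.mem_ker] at hv ⊢
    have := sM.he v
    rw [hv] at this
    simpa using this) w hw (dM w)
  have hk : ∀ k ∈ I, ∃ c : M → A, (∀ t, E (c t) = 0) ∧ g k = ∑ t ∈ s', c t • t := by
    intro k hkI
    by_cases hz : g k = 0
    · rw [hz]; exact h0
    · exact key _ ⟨hgp k hkI, sM.hw (hg k) (hgp k hkI) (nf _) hz⟩
  choose! c hc hcs using hk
  refine ⟨fun t => ∑ k ∈ I, c k t, fun t => ?_, ?_⟩
  · rw [map_sum]; exact Finset.sum_eq_zero fun k hkI => hc k hkI t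
  · rw [Finset.sum_congr rfl hcs, Finset.sum_comm]
    exact Finset.sum_congr rfl fun t _ => by rw [Finset.sum_smul]
end TT

theorem abstract_fg {K A M : Type*} [Field K] [CharZero K] [CommRing A] [Algebra K A]
    [AddCommGroup M] [Module K M] [Module A M] [IsScalarTower K A M]
    [IsNoetherianRing A] [Module.Finite A M]
    {E F H : A →ₗ[K] A} {e f h : M →ₗ[K] M} (hE : IsDer E) (hF : IsDer F) (hH : IsDer H)
    (he : ∀ (a : A) (m : M), e (a • m) = E a • m + a • e m)
    (hf : ∀ (a : A) (m : M), f (a • m) = F a • m + a • f m)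
    (hh : ∀ (a : A) (m : M), h (a • m) = H a • m + a • h m)
    (sA : Sl2 E F H) (sM : Sl2 e f h) (nA : LocNil E) (nM : LocNil e) (dA : IntDiag H)
    (dM : IntDiag h) (nf : LocNil f) :
    ∃ s : Finset M, (∀ t ∈ s, e t = 0) ∧ ∀ w, e w = 0 → ∃ c : M → A, (∀ t, E (c t) = 0) ∧
      w = ∑ t ∈ s, c t • t := by
  letI : Module Aᵐᵒᵖ M := Module.compHom M ((RingHom.id A).fromOpposite mul_comm)
  haveI : IsCentralScalar A M := ⟨fun a m => rfl⟩
  haveI : IsScalarTower K Aᵐᵒᵖ M := ⟨fun k a m => by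
    change (k • a.unop) • m = k • (a.unop • m)
    exact smul_assoc _ _ _⟩
  exact abstract_fg0 hE hF hH he hf hh sA sM nA nM dA dM nf
end Wz

namespace Wz
set_option linter.style.haveILetI false
section ids
variable {R : Type*} [Ring R]
lemma id1 (a b r z : R) : (a * b - b * a) * r * z
    = (a * (b * r) - (b * r) * a) * z - b * ((a * r - r * a) * z) := by noncomm_ring
lemma id2 (a0 b0 c0 e0 a1 b1 c1 e1 : R) :
    (a0 * b0 - b0 * a0) * (c0 * e1 + c1 * e0 - (e0 * c1 + e1 * c0)) +
      (a0 * b1 + a1 * b0 - (b0 * a1 + b1 * a0)) * (c0 * e0 - e0 * c0)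
    = (a0 * b0 - b0 * a0) * (c0 * e1 - e1 * c0) +
        (a0 * b0 - b0 * a0) * (c1 * e0 - e0 * c1) + (a0 * b1 - b1 * a0) * (c0 * e0 - e0 * c0)
        + (a1 * b0 - b0 * a1) * (c0 * e0 - e0 * c0) := by noncomm_ring
lemma id3 (r f g t r' f' g' t' : R) :
    (r' * (f * g - g * f) + r * (f' * g + f * g' - (g' * f + g * f'))) * t
        + r * (f * g - g * f) * t'
      = r' * (f * g - g * f) * t
      + r * (f' * g - g * f') * t + r * (f * g' - g' * f) * t + r * (f * g - g * f) * t' := by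
  noncomm_ring
end ids
section F
variable {K : Type*} [Field K] {d : ℕ}

lemma metab (a b c e : FreeMetab K d) : (a * b - b * a) * (c * e - e * c) = 0 := by
  obtain ⟨a, rfl⟩ := RingQuot.mkAlgHom_surjective K (MetabRel K d) a
  obtain ⟨b, rfl⟩ := RingQuot.mkAlgHom_surjective K (MetabRel K d) b
  obtain ⟨c, rfl⟩ := RingQuot.mkAlgHom_surjective K (MetabRel K d) c
  obtain ⟨e, rfl⟩ := RingQuot.mkAlgHom_surjective K (MetabRel K d) e
  have := RingQuot.mkAlgHom_rel K (s := MetabRel K d)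
    (show MetabRel K d ((a * b - b * a) * (c * e - e * c)) 0 from ⟨rfl, a, b, c, e, rfl⟩)
  simpa using this

lemma metab_mid (a b r c e : FreeMetab K d) :
    (a * b - b * a) * r * (c * e - e * c) = 0 := by
  have h1 := metab a (b * r) c e
  have h2 := metab a r c e
  rw [id1, h1, h2, mul_zero, sub_zero]

lemma adjoin_x : Algebra.adjoin K (Set.range (xg K d)) = ⊤ := by
  have h := congrArg (Subalgebra.map (RingQuot.mkAlgHom K (MetabRel K d)))
    (FreeAlgebra.adjoin_range_ι K (Fin d))
  rw [AlgHom.map_adjoin, Algebra.map_top,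
    (AlgHom.range_eq_top _).2 (RingQuot.mkAlgHom_surjective K (MetabRel K d)), ← Set.range_comp] at h
  exact h

lemma exists_der (y : Fin d → FreeMetab K d) :
    ∃ D : FreeMetab K d →ₗ[K] FreeMetab K d, IsDer D ∧ ∀ j, D (xg K d j) = y j := by
  let g : FreeAlgebra K (Fin d) →ₐ[K] TrivSqZeroExt (FreeMetab K d) (FreeMetab K d) :=
    FreeAlgebra.lift K fun j => (TrivSqZeroExt.inl (xg K d j) + TrivSqZeroExt.inr (y j))
  have hg : ∀ ⦃x y⦄, MetabRel K d x y → g x = g y := by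
    rintro _ _ ⟨rfl, a, b, c, e, rfl⟩
    rw [map_zero]
    simp only [map_mul, map_sub]
    ext
    · simp [metab]
    · simp only [TrivSqZeroExt.snd_mul, TrivSqZeroExt.fst_mul, TrivSqZeroExt.fst_sub,
        TrivSqZeroExt.snd_sub, smul_eq_mul, MulOpposite.smul_eq_mul_unop, MulOpposite.unop_op,
        TrivSqZeroExt.snd_zero]
      generalize (g a).fst = a0
      generalize (g b).fst = b0
      generalize (g c).fst = c0
      generalize (g e).fst = e0
      generalize (g a).snd = a1
      generalize (g b).snd = b1
      generalize (g c).snd = c1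
      generalize (g e).snd = e1
      have h1 := metab a0 b0 c0 e1
      have h2 := metab a0 b0 c1 e0
      have h3 := metab a0 b1 c0 e0
      have h4 := metab a1 b0 c0 e0
      rw [id2, h1, h2, h3, h4, add_zero, add_zero, add_zero]
  let G := RingQuot.liftAlgHom K ⟨g, hg⟩
  have hG : ∀ a, G (RingQuot.mkAlgHom K (MetabRel K d) a) = g a := fun a =>
    RingQuot.liftAlgHom_mkAlgHom_apply K g hg a
  have hx : ∀ j, G (xg K d j) = TrivSqZeroExt.inl (xg K d j) + TrivSqZeroExt.inr (y j) := by
    intro j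
    rw [xg, hG]
    simp [g, xg]
  have hfst : ∀ a, (G a).fst = a := by
    intro a
    have ha : a ∈ Algebra.adjoin K (Set.range (xg K d)) := by rw [adjoin_x]; trivial
    induction ha using Algebra.adjoin_induction with
    | mem x hx' => obtain ⟨j, rfl⟩ := hx'; rw [hx]; simp
    | algebraMap r => rw [AlgHom.commutes]; rfl
    | add x y _ _ h1 h2 => rw [map_add, TrivSqZeroExt.fst_add, h1, h2]
    | mul x y _ _ h1 h2 => rw [map_mul, TrivSqZeroExt.fst_mul, h1, h2]
  refine ⟨⟨⟨fun a => (G a).snd, fun a b => by simp⟩, fun c a => by simp⟩, ?_, ?_⟩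
  · intro a b
    change (G (a * b)).snd = (G a).snd * b + a * (G b).snd
    rw [map_mul, TrivSqZeroExt.snd_mul, hfst, hfst]
    rw [smul_eq_mul, MulOpposite.smul_eq_mul_unop, MulOpposite.unop_op, add_comm]
  · intro j
    change (G (xg K d j)).snd = _
    rw [hx]; simp

lemma Z_comm_mul {m : FreeMetab K d} (hm : m ∈ commIdeal K d) :
    ∀ a b : FreeMetab K d, (a * b - b * a) * m = 0 := by
  unfold commIdeal at hm
  induction hm using Submodule.span_induction with
  | mem x hx =>
    obtain ⟨r, f, g, s, rfl⟩ := hx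
    intro a b
    rw [← mul_assoc, ← mul_assoc, metab_mid, zero_mul]
  | zero => simp
  | add x y _ _ hx hy => intro a b; rw [mul_add, hx, hy, add_zero]
  | smul r x _ hx =>
    intro a b
    rw [smul_eq_mul, ← mul_assoc, id1, hx, hx, mul_zero, sub_zero]

lemma Z_mul_comm {m : FreeMetab K d} (hm : m ∈ commIdeal K d) (a b : FreeMetab K d) :
    m * (a * b - b * a) = 0 := by
  unfold commIdeal at hm
  induction hm using Submodule.span_induction with
  | mem x hx =>
    obtain ⟨r, f, g, s, rfl⟩ := hx
    rw [mul_assoc r, mul_assoc r, metab_mid, mul_zero]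
  | zero => simp
  | add x y _ _ hx hy => rw [add_mul, hx, hy, add_zero]
  | smul r x _ hx => rw [smul_eq_mul, mul_assoc, hx, mul_zero]

lemma Z_right {m : FreeMetab K d} (hm : m ∈ commIdeal K d) (s : FreeMetab K d) :
    m * s ∈ commIdeal K d := by
  unfold commIdeal at hm
  induction hm using Submodule.span_induction with
  | mem x hx =>
    obtain ⟨r, f, g, t, rfl⟩ := hx
    exact Ideal.subset_span ⟨r, f, g, t * s, by rw [mul_assoc _ t s]⟩
  | zero => simp
  | add x y _ _ hx hy => rw [add_mul]; exact Ideal.add_mem _ hx hy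
  | smul r x _ hx => rw [smul_eq_mul, mul_assoc]; exact Ideal.mul_mem_left _ _ hx

lemma Z_comm (a b : FreeMetab K d) : a * b - b * a ∈ commIdeal K d :=
  Ideal.subset_span ⟨1, a, b, 1, by simp⟩

lemma Z_der {D : FreeMetab K d →ₗ[K] FreeMetab K d} (hD : IsDer D) {m : FreeMetab K d}
    (hm : m ∈ commIdeal K d) : D m ∈ commIdeal K d := by
  unfold commIdeal at hm
  induction hm using Submodule.span_induction with
  | mem x hx =>
    obtain ⟨r, f, g, t, rfl⟩ := hx
    have : D (r * (f * g - g * f) * t) = D r * (f * g - g * f) * t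
      + r * (D f * g - g * D f) * t + r * (f * D g - D g * f) * t + r * (f * g - g * f) * D t := by
      rw [hD, hD r, map_sub, hD f, hD g]; exact id3 _ _ _ _ _ _ _ _
    rw [this]
    refine Ideal.add_mem _ (Ideal.add_mem _ (Ideal.add_mem _ ?_ ?_) ?_) ?_ <;>
      exact Ideal.subset_span ⟨_, _, _, _, rfl⟩
  | zero => simp
  | add x y _ _ hx hy => rw [map_add]; exact Ideal.add_mem _ hx hy
  | smul r x hx' hx =>
    rw [smul_eq_mul, hD]
    exact Ideal.add_mem _ (Ideal.mul_mem_left _ _ hx') (Ideal.mul_mem_left _ _ hx)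

/-- Restriction of an operator preserving the commutator ideal. -/
def resZ (D : FreeMetab K d →ₗ[K] FreeMetab K d)
    (hD : ∀ m ∈ commIdeal K d, D m ∈ commIdeal K d) : Module.End K (commIdeal K d) where
  toFun m := ⟨D m, hD m m.2⟩
  map_add' a b := Subtype.ext (by simp)
  map_smul' c a := Subtype.ext (by simp)

@[simp] lemma resZ_coe (D : FreeMetab K d →ₗ[K] FreeMetab K d)
    (hD : ∀ m ∈ commIdeal K d, D m ∈ commIdeal K d) (m : commIdeal K d) :
    (resZ D hD m : FreeMetab K d) = D m := rfl

/-- The operators `u_i`, `v_i` on `F_d`. -/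
def opsF (K : Type*) [Field K] (d : ℕ) (i : Fin d ⊕ Fin d) : Module.End K (FreeMetab K d) :=
  Sum.elim (fun i => LinearMap.mulLeft K (xg K d i))
    (fun i => LinearMap.mulRight K (xg K d i) - LinearMap.mulLeft K (xg K d i)) i

lemma opsF_mem (i : Fin d ⊕ Fin d) (m : FreeMetab K d) (hm : m ∈ commIdeal K d) :
    opsF K d i m ∈ commIdeal K d := by
  rcases i with i | i
  · exact Ideal.mul_mem_left _ _ hm
  · exact Ideal.sub_mem _ (Z_right hm _) (Ideal.mul_mem_left _ _ hm)

/-- The operators `u_i`, `v_i` on the commutator ideal. -/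
def opsZ (K : Type*) [Field K] (d : ℕ) (i : Fin d ⊕ Fin d) : Module.End K (commIdeal K d) :=
  resZ (opsF K d i) (opsF_mem i)

lemma opsF_comm (i j : Fin d ⊕ Fin d) (m : FreeMetab K d) (hm : m ∈ commIdeal K d) :
    opsF K d i (opsF K d j m) = opsF K d j (opsF K d i m) := by
  have hL : ∀ a b : FreeMetab K d, a * (b * m) = b * (a * m) := fun a b => by
    have := Z_comm_mul hm a b
    rw [sub_mul, sub_eq_zero] at this
    rw [← mul_assoc, this, mul_assoc]
  have hR : ∀ a b : FreeMetab K d, m * a * b = m * b * a := fun a b => by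
    have := Z_mul_comm hm a b
    rw [mul_sub, sub_eq_zero] at this
    rw [mul_assoc, this, mul_assoc]
  rcases i with i | i <;> rcases j with j | j <;>
    simp only [opsF, Sum.elim_inl, Sum.elim_inr, LinearMap.sub_apply, LinearMap.mulLeft_apply,
      LinearMap.mulRight_apply, mul_sub, sub_mul]
  · exact hL _ _
  · rw [hL, mul_assoc]
  · rw [hL, mul_assoc]
  · rw [hL (xg K d i), hR (xg K d j), mul_assoc (xg K d j), mul_assoc (xg K d i)]; abel

open scoped IsMulCommutative in
lemma exists_hom {ι B : Type*} [Semiring B] [Algebra K B] (g : ι → B)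
    (hc : ∀ i j, g i * g j = g j * g i) :
    ∃ ρ : MvPolynomial ι K →ₐ[K] B, ∀ i, ρ (MvPolynomial.X i) = g i := by
  have : IsMulCommutative (Algebra.adjoin K (Set.range g)) :=
    Algebra.isMulCommutative_adjoin K (by rintro _ ⟨i, rfl⟩ _ ⟨j, rfl⟩; exact hc i j)
  let ρ0 : MvPolynomial ι K →ₐ[K] Algebra.adjoin K (Set.range g) :=
    MvPolynomial.aeval fun i => ⟨g i, Algebra.subset_adjoin ⟨i, rfl⟩⟩
  refine ⟨(Algebra.adjoin K (Set.range g)).val.comp ρ0, fun i => ?_⟩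
  simp [ρ0]

lemma list_intertwine {V W : Type*} [AddCommMonoid V] [Module K V] [AddCommMonoid W]
    [Module K W] (φ : V →ₗ[K] W) (n : ℕ) (a : Fin n → Module.End K V) (b : Fin n → Module.End K W)
    (hab : ∀ i v, b i (φ v) = φ (a i v)) (v : V) :
    (List.ofFn b).prod (φ v) = φ ((List.ofFn a).prod v) := by
  induction n with
  | zero => simp
  | succ n ih =>
    rw [List.ofFn_succ, List.ofFn_succ, List.prod_cons, List.prod_cons, Module.End.mul_apply,
      Module.End.mul_apply, ih (fun i => a i.succ) (fun i => b i.succ) (fun i v => hab _ v), hab]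

end F
end Wz

namespace Wz
set_option linter.style.haveILetI false
section G
variable {K : Type*} [Field K] {d : ℕ}

/-- Inclusion of the commutator ideal. -/
def inZ (K : Type*) [Field K] (d : ℕ) : commIdeal K d →ₗ[K] FreeMetab K d where
  toFun m := m
  map_add' _ _ := rfl
  map_smul' _ _ := rfl

lemma rho_act {ρ : PolyUV K d →ₐ[K] Module.End K (commIdeal K d)}
    (hρ : ∀ i, ρ (MvPolynomial.X i) = opsZ K d i) (p : PolyUV K d) (m : commIdeal K d) :
    (ρ p m : FreeMetab K d) = act K d p m := by
  have hmon : ∀ s : (Fin d ⊕ Fin d) →₀ ℕ, inZ K d (ρ (MvPolynomial.monomial s 1) m)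
      = monAct K d s (inZ K d m) := by
    intro s
    have h1 : (MvPolynomial.monomial s 1 : PolyUV K d)
      = (List.ofFn fun i : Fin d => (MvPolynomial.X (Sum.inl i) : PolyUV K d) ^ s (Sum.inl i)).prod
      * (List.ofFn fun i : Fin d => (MvPolynomial.X (Sum.inr i) : PolyUV K d) ^ s (Sum.inr i)).prod := by
      rw [List.prod_ofFn, List.prod_ofFn, MvPolynomial.monomial_eq, Finsupp.prod_fintype _ _ (by simp),
        Fintype.prod_sum_type]
      simp
    rw [h1, map_mul, map_list_prod, map_list_prod, List.map_ofFn, List.map_ofFn, monAct,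
      Module.End.mul_apply, Module.End.mul_apply]
    rw [list_intertwine (inZ K d) d _ _ ?_ m, list_intertwine (inZ K d) d _ _ ?_ _]
    · intro i v
      simp only [Function.comp_apply, map_pow, hρ]
      exact pow_intertwine (inZ K d) (opsZ K d (Sum.inl i)) (opsF K d (Sum.inl i)) (fun v => rfl) _ v
    · intro i v
      simp only [Function.comp_apply, map_pow, hρ]
      exact pow_intertwine (inZ K d) (opsZ K d (Sum.inr i)) (opsF K d (Sum.inr i)) (fun v => rfl) _ v
  have h2 : ρ p = ∑ s ∈ p.support, p.coeff s • ρ (MvPolynomial.monomial s 1) := by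
    conv_lhs => rw [MvPolynomial.as_sum p, map_sum]
    refine Finset.sum_congr rfl fun s _ => ?_
    rw [← map_smul, MvPolynomial.smul_monomial, smul_eq_mul, mul_one]
  change inZ K d (ρ p m) = ∑ s ∈ p.support, p.coeff s • monAct K d s (inZ K d m)
  rw [h2, LinearMap.sum_apply, map_sum]
  refine Finset.sum_congr rfl fun s _ => ?_
  rw [LinearMap.smul_apply, map_smul, hmon]

lemma rho_leib {ρ : PolyUV K d →ₐ[K] Module.End K (commIdeal K d)}
    (hρ : ∀ i, ρ (MvPolynomial.X i) = opsZ K d i) (β : Matrix (Fin d) (Fin d) K)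
    {D : FreeMetab K d →ₗ[K] FreeMetab K d} (hD : IsDer D)
    (hDx : ∀ j, D (xg K d j) = ∑ i, β i j • xg K d i)
    {E : PolyUV K d →ₗ[K] PolyUV K d} (hE : IsDer E)
    (hu : ∀ j, E (uP K d j) = ∑ i, β i j • uP K d i)
    (hv : ∀ j, E (vP K d j) = ∑ i, β i j • vP K d i) (p : PolyUV K d) :
    ∀ m : commIdeal K d, resZ D (fun _ h => Z_der hD h) (ρ p m) =
      ρ (E p) m + ρ p (resZ D (fun _ h => Z_der hD h) m) := by
  induction p using MvPolynomial.induction_on with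
  | C c =>
    intro m
    rw [← MvPolynomial.algebraMap_eq, hE.algebraMap, map_zero, AlgHom.commutes,
      Module.algebraMap_end_apply, Module.algebraMap_end_apply, map_smul]
    simp
  | add p q hp hq =>
    intro m
    simp only [map_add, LinearMap.add_apply, hp, hq]
    abel
  | mul_X p k hp =>
    intro m
    have hk : resZ D (fun _ h => Z_der hD h) (opsZ K d k m) = ρ (E (MvPolynomial.X k)) m
        + opsZ K d k (resZ D (fun _ h => Z_der hD h) m) := by
      rcases k with k | k
      · have h1 : ρ (E (MvPolynomial.X (Sum.inl k))) = ∑ i, β i k • opsZ K d (Sum.inl i) := by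
          have := hu k
          unfold uP at this
          rw [this, map_sum]
          exact Finset.sum_congr rfl fun i _ => by rw [map_smul, hρ]
        rw [h1]
        apply Subtype.ext
        rw [LinearMap.sum_apply]
        simp only [opsZ, opsF, Sum.elim_inl, resZ_coe, LinearMap.mulLeft_apply,
          Submodule.coe_add, Submodule.coe_sum, LinearMap.smul_apply]
        rw [hD, hDx, Finset.sum_mul]
        congr 1
        exact Finset.sum_congr rfl fun i _ => by rw [smul_mul_assoc]; rfl
      · have h1 : ρ (E (MvPolynomial.X (Sum.inr k))) = ∑ i, β i k • opsZ K d (Sum.inr i) := by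
          have := hv k
          unfold vP at this
          rw [this, map_sum]
          exact Finset.sum_congr rfl fun i _ => by rw [map_smul, hρ]
        rw [h1]
        apply Subtype.ext
        rw [LinearMap.sum_apply]
        have h2 : ((∑ i, (β i k • opsZ K d (Sum.inr i)) m : commIdeal K d) : FreeMetab K d)
            = (m : FreeMetab K d) * D (xg K d k) - D (xg K d k) * m := by
          rw [hDx, Finset.sum_mul, Finset.mul_sum, ← Finset.sum_sub_distrib, Submodule.coe_sum]
          refine Finset.sum_congr rfl fun i _ => ?_
          rw [smul_mul_assoc, mul_smul_comm]
          exact smul_sub (β i k) ((m : FreeMetab K d) * xg K d i) (xg K d i * (m : FreeMetab K d))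
        rw [Submodule.coe_add, h2]
        simp only [opsZ, opsF, Sum.elim_inr, resZ_coe, LinearMap.mulLeft_apply,
          LinearMap.sub_apply, LinearMap.mulRight_apply]
        rw [map_sub, hD, hD]
        abel
    rw [hE, map_mul, map_add, map_mul, map_mul, hρ, Module.End.mul_apply, hp, hk, map_add]
    simp only [LinearMap.add_apply, Module.End.mul_apply]
    abel

lemma finite_Z [Module (PolyUV K d) (commIdeal K d)]
    [IsScalarTower K (PolyUV K d) (commIdeal K d)]
    (hX : ∀ i (m : commIdeal K d), (MvPolynomial.X i : PolyUV K d) • m = opsZ K d i m) :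
    Module.Finite (PolyUV K d) (commIdeal K d) := by
  classical
  let S : Set (commIdeal K d) := Set.range fun ij : Fin d × Fin d =>
    (⟨xg K d ij.1 * xg K d ij.2 - xg K d ij.2 * xg K d ij.1, Z_comm _ _⟩ : commIdeal K d)
  let N := Submodule.span (PolyUV K d) S
  let N' : Submodule K (FreeMetab K d) := (N.restrictScalars K).map (inZ K d)
  have hmem : ∀ w (hw : w ∈ commIdeal K d), w ∈ N' → (⟨w, hw⟩ : commIdeal K d) ∈ N := by
    rintro w hw ⟨m, hm, rfl⟩
    exact hm
  have hLx : ∀ i, ∀ w ∈ N', xg K d i * w ∈ N' := by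
    rintro i _ ⟨m, hm, rfl⟩
    refine ⟨(MvPolynomial.X (Sum.inl i) : PolyUV K d) • m, N.smul_mem _ hm, ?_⟩
    rw [hX]; rfl
  have hRx : ∀ i, ∀ w ∈ N', w * xg K d i ∈ N' := by
    rintro i _ ⟨m, hm, rfl⟩
    refine ⟨(MvPolynomial.X (Sum.inr i) : PolyUV K d) • m
      + (MvPolynomial.X (Sum.inl i) : PolyUV K d) • m,
      N.add_mem (N.smul_mem _ hm) (N.smul_mem _ hm), ?_⟩
    rw [hX, hX, map_add]
    exact sub_add_cancel (inZ K d m * xg K d i) (xg K d i * inZ K d m)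
  have hL : ∀ r, ∀ w ∈ N', r * w ∈ N' := by
    intro r
    have hr : r ∈ Algebra.adjoin K (Set.range (xg K d)) := by rw [adjoin_x]; trivial
    induction hr using Algebra.adjoin_induction with
    | mem x hx => obtain ⟨i, rfl⟩ := hx; exact hLx i
    | algebraMap c => intro w hw; rw [← Algebra.smul_def]; exact N'.smul_mem _ hw
    | add x y _ _ hx hy => intro w hw; rw [add_mul]; exact N'.add_mem (hx w hw) (hy w hw)
    | mul x y _ _ hx hy => intro w hw; rw [mul_assoc]; exact hx _ (hy w hw)
  have hR : ∀ r, ∀ w ∈ N', w * r ∈ N' := by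
    intro r
    have hr : r ∈ Algebra.adjoin K (Set.range (xg K d)) := by rw [adjoin_x]; trivial
    induction hr using Algebra.adjoin_induction with
    | mem x hx => obtain ⟨i, rfl⟩ := hx; exact hRx i
    | algebraMap c =>
      intro w hw
      rw [← Algebra.commutes, ← Algebra.smul_def]; exact N'.smul_mem _ hw
    | add x y _ _ hx hy => intro w hw; rw [mul_add]; exact N'.add_mem (hx w hw) (hy w hw)
    | mul x y _ _ hx hy => intro w hw; rw [← mul_assoc]; exact hy _ (hx w hw)
  have hC1 : ∀ a, ∀ j, a * xg K d j - xg K d j * a ∈ N' := by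
    intro a
    have hr : a ∈ Algebra.adjoin K (Set.range (xg K d)) := by rw [adjoin_x]; trivial
    induction hr using Algebra.adjoin_induction with
    | mem x hx =>
      obtain ⟨i, rfl⟩ := hx
      intro j
      exact ⟨_, Submodule.subset_span ⟨(i, j), rfl⟩, rfl⟩
    | algebraMap c => intro j; rw [Algebra.commutes, sub_self]; exact N'.zero_mem
    | add x y _ _ hx hy =>
      intro j
      rw [add_mul, mul_add, add_sub_add_comm]; exact N'.add_mem (hx j) (hy j)
    | mul x y _ _ hx hy =>
      intro j
      have : x * y * xg K d j - xg K d j * (x * y)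
        = x * (y * xg K d j - xg K d j * y) + (x * xg K d j - xg K d j * x) * y := by
        rw [mul_sub, sub_mul, mul_assoc, mul_assoc, mul_assoc]; abel
      rw [this]
      exact N'.add_mem (hL _ _ (hy j)) (hR _ _ (hx j))
  have hC : ∀ b a, a * b - b * a ∈ N' := by
    intro b
    have hr : b ∈ Algebra.adjoin K (Set.range (xg K d)) := by rw [adjoin_x]; trivial
    induction hr using Algebra.adjoin_induction with
    | mem x hx => obtain ⟨i, rfl⟩ := hx; exact fun a => hC1 a i
    | algebraMap c => intro j; rw [Algebra.commutes, sub_self]; exact N'.zero_mem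
    | add x y _ _ hx hy =>
      intro j
      rw [add_mul, mul_add, add_sub_add_comm]; exact N'.add_mem (hx j) (hy j)
    | mul x y _ _ hx hy =>
      intro a
      have : a * (x * y) - x * y * a = (a * x - x * a) * y + x * (a * y - y * a) := by
        rw [mul_sub, sub_mul, mul_assoc, mul_assoc, mul_assoc]; abel
      rw [this]
      exact N'.add_mem (hR _ _ (hx a)) (hL _ _ (hy a))
  have hall : ∀ w ∈ commIdeal K d, w ∈ N' := by
    intro w hw
    unfold commIdeal at hw
    induction hw using Submodule.span_induction with
    | mem x hx =>
      obtain ⟨r, f, g, t, rfl⟩ := hx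
      exact hR _ _ (hL _ _ (hC g f))
    | zero => exact N'.zero_mem
    | add x y _ _ hx hy => exact N'.add_mem hx hy
    | smul r x _ hx => exact hL _ _ hx
  refine Module.Finite.of_fg_top ?_
  have : N = ⊤ := by
    rw [eq_top_iff]
    rintro ⟨w, hw⟩ _
    exact hmem w hw (hall w hw)
  rw [← this]
  exact Submodule.fg_span (Set.finite_range _)

lemma transfer {R κ V : Type*} [Ring R] [Algebra K R] [AddCommGroup V] [Module K V]
    (φ : κ → V →ₗ[K] R) (hS : Algebra.adjoin K {x | ∃ k v, x = φ k v} = ⊤)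
    {e f h : V →ₗ[K] V} (hs : Sl2 e f h) (he : LocNil e) (hf : LocNil f) (hh : IntDiag h)
    {E F H : R →ₗ[K] R} (hE : IsDer E) (hF : IsDer F) (hH : IsDer H)
    (iE : ∀ k v, E (φ k v) = φ k (e v)) (iF : ∀ k v, F (φ k v) = φ k (f v))
    (iH : ∀ k v, H (φ k v) = φ k (h v)) : Sl2 E F H ∧ LocNil E ∧ LocNil F ∧ IntDiag H := by
  refine ⟨sl2_of_adjoin hE hF hH _ hS ?_ ?_ ?_, locNil_of_adjoin hE _ hS ?_,
    locNil_of_adjoin hF _ hS ?_, intDiag_of_adjoin hH _ hS ?_⟩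
  · rintro _ ⟨k, v, rfl⟩
    rw [iF, iE, iE, iF, iH, ← map_sub, hs.ef]
  · rintro _ ⟨k, v, rfl⟩
    rw [iE, iH, iH, iE, ← map_sub, hs.he, map_smul]
  · rintro _ ⟨k, v, rfl⟩
    rw [iF, iH, iH, iF, ← map_sub, hs.hf, map_neg, map_smul]
  · rintro _ ⟨k, v, rfl⟩
    obtain ⟨n, hn⟩ := he v
    exact ⟨n, by rw [pow_intertwine (φ k) e E (iE k), hn, map_zero]⟩
  · rintro _ ⟨k, v, rfl⟩
    obtain ⟨n, hn⟩ := hf v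
    exact ⟨n, by rw [pow_intertwine (φ k) f F (iF k), hn, map_zero]⟩
  · rintro _ ⟨k, v, rfl⟩
    exact intSp_map (φ k) h H (iH k) v (hh v)

lemma lc_intertwine {R : Type*} [AddCommGroup R] [Module K R] (x : Fin d → R) (D : R →ₗ[K] R)
    (β : Matrix (Fin d) (Fin d) K) (h : ∀ j, D (x j) = ∑ i, β i j • x i) (v : Fin d → K) :
    D (Fintype.linearCombination K x v) = Fintype.linearCombination K x (Matrix.toLin' β v) := by
  simp only [Fintype.linearCombination_apply, map_sum, map_smul, h, Matrix.toLin'_apply,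
    Matrix.mulVec, dotProduct, Finset.sum_smul, Finset.smul_sum, smul_smul]
  rw [Finset.sum_comm]
  exact Finset.sum_congr rfl fun i _ => Finset.sum_congr rfl fun j _ => by rw [mul_comm]

/-- The derivation of the polynomial algebra induced by a matrix. -/
def derA (β : Matrix (Fin d) (Fin d) K) : Derivation K (PolyUV K d) (PolyUV K d) :=
  MvPolynomial.mkDerivation K (Sum.elim (fun j => ∑ i, β i j • uP K d i)
    (fun j => ∑ i, β i j • vP K d i))

lemma derA_u (β : Matrix (Fin d) (Fin d) K) (j : Fin d) :
    derA β (uP K d j) = ∑ i, β i j • uP K d i := by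
  rw [derA, uP, MvPolynomial.mkDerivation_X]; rfl

lemma derA_v (β : Matrix (Fin d) (Fin d) K) (j : Fin d) :
    derA β (vP K d j) = ∑ i, β i j • vP K d i := by
  rw [derA, vP, MvPolynomial.mkDerivation_X]; rfl

lemma isDer_der (D : Derivation K (PolyUV K d) (PolyUV K d)) :
    IsDer (D : PolyUV K d →ₗ[K] PolyUV K d) := by
  intro a b
  simp only [Derivation.coeFn_coe, Derivation.leibniz, smul_eq_mul]
  ring

lemma adjoin_F : Algebra.adjoin K
    {x : FreeMetab K d | ∃ (_ : Unit) (v : Fin d → K), x = Fintype.linearCombination K (xg K d) v}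
    = ⊤ := by
  rw [eq_top_iff, ← adjoin_x]
  refine Algebra.adjoin_mono ?_
  rintro _ ⟨j, rfl⟩
  refine ⟨(), Pi.single j 1, ?_⟩
  rw [Fintype.linearCombination_apply_single, one_smul]

lemma adjoin_A : Algebra.adjoin K
    {x : PolyUV K d | ∃ (k : Bool) (v : Fin d → K),
      x = Fintype.linearCombination K (if k then uP K d else vP K d) v} = ⊤ := by
  rw [eq_top_iff, ← MvPolynomial.adjoin_range_X]
  refine Algebra.adjoin_mono ?_
  rintro _ ⟨j | j, rfl⟩
  · refine ⟨true, Pi.single j 1, ?_⟩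
    rw [Fintype.linearCombination_apply_single, one_smul]; rfl
  · refine ⟨false, Pi.single j 1, ?_⟩
    rw [Fintype.linearCombination_apply_single, one_smul]; rfl

end G
end Wz

open Wz in
/-- For any Weitzenböck derivation `δ` of the free metabelian
associative algebra `F_d`, the space of constants `(F_d')^δ` is a finitely generated
module over the algebra of constants `K[U_d,V_d]^δ`. -/
theorem constants_of_commutator_ideal_finitely_generated
    (K : Type*) [Field K] [CharZero K] (d : ℕ) (hd : 2 ≤ d)
    (α : Matrix (Fin d) (Fin d) K) (hnil : IsNilpotent α) (hne : α ≠ 0)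
    (δ : FreeMetab K d →ₗ[K] FreeMetab K d)
    (hleib : ∀ a b : FreeMetab K d, δ (a * b) = δ a * b + a * δ b)
    (hδx : ∀ j, δ (xg K d j) = ∑ i, α i j • xg K d i)
    (δ' : Derivation K (PolyUV K d) (PolyUV K d))
    (hu : ∀ j, δ' (uP K d j) = ∑ i, α i j • uP K d i)
    (hv : ∀ j, δ' (vP K d j) = ∑ i, α i j • vP K d i) :
    ∃ (n : ℕ) (s : Fin n → FreeMetab K d),
      (∀ t, s t ∈ commIdeal K d ∧ δ (s t) = 0) ∧
      ∀ w ∈ commIdeal K d, δ w = 0 →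
        ∃ h : Fin n → PolyUV K d,
          (∀ t, δ' (h t) = 0) ∧ w = ∑ t, act K d (h t) (s t) := by
  classical
  have hδ : IsDer δ := hleib
  obtain ⟨N, hN⟩ := hnil
  have hpow : (Matrix.toLin' α) ^ N = 0 := by rw [← Matrix.toLin'_pow, hN, map_zero]
  have hnile : LocNil (Matrix.toLin' α) := fun v => ⟨N, by rw [hpow]; rfl⟩
  obtain ⟨f, h, hs, nf, dh⟩ := jacobson_morozov (Matrix.toLin' α) ⟨N, hpow⟩
  obtain ⟨β, rfl⟩ : ∃ β, f = Matrix.toLin' β := ⟨_, (Matrix.toLin'_toMatrix' f).symm⟩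
  obtain ⟨γ, rfl⟩ : ∃ γ, h = Matrix.toLin' γ := ⟨_, (Matrix.toLin'_toMatrix' h).symm⟩
  obtain ⟨Df, hDf, hDfx⟩ := exists_der (K := K) (d := d) fun j => ∑ i, β i j • xg K d i
  obtain ⟨Dh, hDh, hDhx⟩ := exists_der (K := K) (d := d) fun j => ∑ i, γ i j • xg K d i
  obtain ⟨sF, nE, nF, dH⟩ := transfer (fun _ : Unit => Fintype.linearCombination K (xg K d))
    adjoin_F hs hnile nf dh hδ hDf hDh (fun _ => lc_intertwine _ _ _ hδx)
    (fun _ => lc_intertwine _ _ _ hDfx) (fun _ => lc_intertwine _ _ _ hDhx)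
  have lcA : ∀ (D : Derivation K (PolyUV K d) (PolyUV K d)) (β : Matrix (Fin d) (Fin d) K),
      (∀ j, D (uP K d j) = ∑ i, β i j • uP K d i) → (∀ j, D (vP K d j) = ∑ i, β i j • vP K d i) →
      ∀ (k : Bool) v, (D : PolyUV K d →ₗ[K] PolyUV K d)
        (Fintype.linearCombination K (if k then uP K d else vP K d) v)
        = Fintype.linearCombination K (if k then uP K d else vP K d) (Matrix.toLin' β v) := by
    intro D β h1 h2 k
    refine lc_intertwine _ _ _ ?_
    cases k
    · exact h2
    · exact h1
  obtain ⟨sA, nA, -, dA⟩ := transfer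
    (fun k : Bool => Fintype.linearCombination K (if k then uP K d else vP K d))
    adjoin_A hs hnile nf dh (isDer_der δ') (isDer_der (derA β)) (isDer_der (derA γ))
    (lcA _ _ hu hv) (lcA _ _ (derA_u β) (derA_v β)) (lcA _ _ (derA_u γ) (derA_v γ))
  obtain ⟨ρ, hρ⟩ := exists_hom (K := K) (opsZ K d) (fun i j => LinearMap.ext fun m =>
    Subtype.ext (opsF_comm (K := K) i j (m : FreeMetab K d) m.2))
  letI : Module (PolyUV K d) (commIdeal K d) := Module.compHom _ ρ.toRingHom
  have hsm : ∀ (p : PolyUV K d) (m : commIdeal K d), p • m = ρ p m := fun _ _ => rfl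
  haveI : IsScalarTower K (PolyUV K d) (commIdeal K d) := ⟨fun c p m => by
    rw [hsm, hsm, map_smul]; rfl⟩
  haveI := finite_Z (K := K) (d := d) (fun i m => by rw [hsm, hρ])
  let e' := resZ δ (fun _ h => Z_der hδ h)
  let f' := resZ Df (fun _ h => Z_der hDf h)
  let h' := resZ Dh (fun _ h => Z_der hDh h)
  have sM : Sl2 (K := K) (V := commIdeal K d) e' f' h' :=
    ⟨fun v : commIdeal K d => Subtype.ext (sF.ef (v : FreeMetab K d)),
      fun v : commIdeal K d => Subtype.ext (sF.he (v : FreeMetab K d)),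
      fun v : commIdeal K d => Subtype.ext (sF.hf (v : FreeMetab K d))⟩
  have resNil : ∀ (D : FreeMetab K d →ₗ[K] FreeMetab K d)
      (hD : ∀ m ∈ commIdeal K d, D m ∈ commIdeal K d), LocNil D →
        LocNil (K := K) (V := commIdeal K d) (resZ D hD) := by
    intro D hD hn m
    obtain ⟨n, hn⟩ := hn m
    refine ⟨n, Subtype.ext ?_⟩
    have := pow_intertwine (inZ K d) (resZ D hD) D (fun _ => rfl) n m
    exact this.symm.trans hn
  have dM : IntDiag (K := K) (V := commIdeal K d) h' := by
    intro m
    obtain ⟨I, g, hg, hgI, hm⟩ := decomp Dh ((commIdeal K d).restrictScalars K)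
      (fun v hv => Z_der hDh hv) (m : FreeMetab K d) m.2 (dH _)
    have : m = ∑ k ∈ I.attach, (⟨g k, hgI k k.2⟩ : commIdeal K d) := by
      apply Subtype.ext
      rw [hm, Submodule.coe_sum]
      exact (Finset.sum_attach I g).symm
    rw [this]
    refine Submodule.sum_mem _ fun k _ => Submodule.subset_span ⟨k, Subtype.ext (hg k)⟩
  obtain ⟨s, hs0, hs1⟩ := abstract_fg (K := K) (A := PolyUV K d) (M := commIdeal K d)
    (isDer_der δ') (isDer_der (derA β)) (isDer_der (derA γ))
    (rho_leib hρ α hδ hδx (isDer_der δ') hu hv)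
    (rho_leib hρ β hDf hDfx (isDer_der _) (derA_u β) (derA_v β))
    (rho_leib hρ γ hDh hDhx (isDer_der _) (derA_u γ) (derA_v γ))
    sA sM nA (resNil _ _ nE) dA dM (resNil _ _ nF)
  refine ⟨s.card, fun t => ((s.equivFin.symm t : commIdeal K d) : FreeMetab K d), fun t => ?_, ?_⟩
  · exact ⟨(s.equivFin.symm t : commIdeal K d).2,
      congrArg Subtype.val (hs0 _ (s.equivFin.symm t).2)⟩
  · intro w hw hw0
    obtain ⟨c, hc, hcw⟩ := hs1 ⟨w, hw⟩ (Subtype.ext hw0)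
    refine ⟨fun t => c (s.equivFin.symm t), fun t => hc _, ?_⟩
    have h1 := congrArg Subtype.val hcw
    rw [Submodule.coe_sum] at h1
    change w = _ at h1
    rw [h1, ← Finset.sum_coe_sort s, ← Equiv.sum_comp s.equivFin.symm]
    refine Finset.sum_congr rfl fun t _ => ?_
    rw [hsm, rho_act hρ]
end
end

section
/- The multigraded Hilbert series of the free metabelian associative algebra F_d is H(F_d, z_1,…,z_d) = ∏_{j=1}^d (1−z_j)^{−1} · ( 2 + (z_1+⋯+z_d −1)·∏_{j=1}^d (1−z_j)^{−1} ); equivalently, in ℤ[[z_1,…,z_d]] one has ∏_{j=1}^d (1−z_j)² · H(F_d, z_1,…,z_d) = 2·∏_{j=1}^d (1−z_j) + (z_1+⋯+z_d−1). -/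
noncomputable section

/-- The multihomogeneous component of `F_d` of multidegree `n : Fin d →₀ ℕ`:
the image in `F_d` of the span of the words in which each variable `x_i`
occurs exactly `n i` times. -/
def multiComp (K : Type*) [CommRing K] (d : ℕ) (n : Fin d →₀ ℕ) :
    Submodule K (FreeMetab K d) :=
  Submodule.map (RingQuot.mkAlgHom K (MetabRel K d)).toLinearMap
    (Submodule.span K {w : FreeAlgebra K (Fin d) | ∃ l : List (Fin d),
      (∀ i, l.count i = n i) ∧ w = (l.map (FreeAlgebra.ι K)).prod})

/-- The multigraded Hilbert series of `F_d`, as a formal power series over `ℤ`. -/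
def hilbertF (K : Type*) [CommRing K] (d : ℕ) : MvPowerSeries (Fin d) ℤ :=
  fun n => (Module.finrank K (multiComp K d n) : ℤ)

namespace HSM

/-- Exponent vectors. -/
abbrev N (d : ℕ) := Fin d →₀ ℕ

/-- Edges of the lattice: an edge labelled `i` with start `a` and complement `b` of its end. -/
abbrev Edge (d : ℕ) := (_ : Fin d) × (N d × N d)

/-- The basis vector `e_i`. -/
def ev {d : ℕ} (i : Fin d) : N d := Finsupp.single i 1

/-- Multidegree of a word. -/
def deg {d : ℕ} (l : List (Fin d)) : N d := Multiset.toFinsupp (l : Multiset (Fin d))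

/-- A chosen word of given degree. -/
def srt {d : ℕ} (a : N d) : List (Fin d) := (Finsupp.toMultiset a).toList

lemma deg_nil {d : ℕ} : deg ([] : List (Fin d)) = 0 := by
  simp [deg]

lemma deg_cons {d : ℕ} (i : Fin d) (l : List (Fin d)) : deg (i :: l) = ev i + deg l := by
  rw [deg, ← Multiset.cons_coe, ← Multiset.singleton_add, Multiset.toFinsupp_add,
    Multiset.toFinsupp_singleton]
  rfl

lemma deg_append {d : ℕ} (l m : List (Fin d)) : deg (l ++ m) = deg l + deg m := by
  rw [deg, ← Multiset.coe_add, Multiset.toFinsupp_add]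
  rfl

lemma deg_srt {d : ℕ} (a : N d) : deg (srt a) = a := by
  simp [deg, srt]

lemma srt_zero {d : ℕ} : srt (0 : N d) = [] := by
  simp [srt]

lemma perm_of_deg {d : ℕ} {l m : List (Fin d)} (h : deg l = deg m) : l.Perm m := by
  rw [deg, deg] at h
  exact Multiset.coe_eq_coe.mp (Multiset.toFinsupp.injective h)

lemma deg_eq_iff {d : ℕ} (l : List (Fin d)) (n : N d) : deg l = n ↔ ∀ i, l.count i = n i := by
  rw [Finsupp.ext_iff]
  simp [deg]

/-- The sum of edges along the path of a word started at `a`, followed by `b`. -/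
def path (K : Type*) [Field K] {d : ℕ} : N d → List (Fin d) → N d → (Edge d →₀ K)
  | _, [], _ => 0
  | a, i :: l, b => Finsupp.single ⟨i, a, deg l + b⟩ 1 + path K (a + ev i) l b

lemma path_append (K : Type*) [Field K] {d : ℕ} (l m : List (Fin d)) (a b : N d) :
    path K a (l ++ m) b = path K a l (deg m + b) + path K (a + deg l) m b := by
  induction l generalizing a with
  | nil => simp [path, deg_nil]
  | cons i l ih =>
    simp only [List.cons_append, path, ih, deg_append, deg_cons]
    simp only [add_assoc]

/-- The image of a word in `F_d`. -/
def wd (K : Type*) [Field K] {d : ℕ} (l : List (Fin d)) : FreeMetab K d :=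
  (l.map (xg K d)).prod

lemma wd_cons (K : Type*) [Field K] {d : ℕ} (i : Fin d) (l : List (Fin d)) :
    wd K (i :: l) = xg K d i * wd K l := by simp [wd]

lemma wd_nil (K : Type*) [Field K] {d : ℕ} : wd K ([] : List (Fin d)) = 1 := by simp [wd]

lemma wd_append (K : Type*) [Field K] {d : ℕ} (l m : List (Fin d)) :
    wd K (l ++ m) = wd K l * wd K m := by simp [wd]

lemma mk_word (K : Type*) [Field K] {d : ℕ} (l : List (Fin d)) :
    RingQuot.mkAlgHom K (MetabRel K d) (l.map (FreeAlgebra.ι K)).prod = wd K l := by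
  rw [wd, map_list_prod, List.map_map]
  rfl

lemma multiComp_eq (K : Type*) [Field K] {d : ℕ} (n : N d) :
    multiComp K d n = Submodule.span K {w | ∃ l : List (Fin d), deg l = n ∧ w = wd K l} := by
  rw [multiComp, Submodule.map_span]
  congr 1
  ext w
  constructor
  · rintro ⟨_, ⟨l, hl, rfl⟩, rfl⟩
    exact ⟨l, (deg_eq_iff l n).2 hl, mk_word K l⟩
  · rintro ⟨l, hl, rfl⟩
    exact ⟨_, ⟨l, (deg_eq_iff l n).1 hl, rfl⟩, mk_word K l⟩

lemma comm_comm (K : Type*) [Field K] {d : ℕ} (a b c e : FreeMetab K d) :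
    (a * b - b * a) * (c * e - e * c) = 0 := by
  obtain ⟨a, rfl⟩ := RingQuot.mkAlgHom_surjective K (MetabRel K d) a
  obtain ⟨b, rfl⟩ := RingQuot.mkAlgHom_surjective K (MetabRel K d) b
  obtain ⟨c, rfl⟩ := RingQuot.mkAlgHom_surjective K (MetabRel K d) c
  obtain ⟨e, rfl⟩ := RingQuot.mkAlgHom_surjective K (MetabRel K d) e
  have h : MetabRel K d ((a * b - b * a) * (c * e - e * c)) 0 := ⟨rfl, a, b, c, e, rfl⟩
  simpa using RingQuot.mkAlgHom_rel K h

lemma comm_mul_comm (K : Type*) [Field K] {d : ℕ} (a b y c e : FreeMetab K d) :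
    (a * b - b * a) * y * (c * e - e * c) = 0 := by
  have h1 := comm_comm K a b (y * c) e
  have h2 := comm_comm K a b y e
  have : (a * b - b * a) * y * (c * e - e * c)
      = (a * b - b * a) * (y * c * e - e * (y * c))
        - (a * b - b * a) * (y * e - e * y) * c := by
    simp only [mul_sub, sub_mul, mul_assoc]
    abel
  rw [this, h1, h2]; simp

lemma perm_left (K : Type*) [Field K] {d : ℕ} {p q : List (Fin d)} (h : p.Perm q) :
    ∀ y c e : FreeMetab K d, (wd K p - wd K q) * y * (c * e - e * c) = 0 := by
  induction h with
  | nil => intro y c e; simp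
  | cons i _ ih =>
    intro y c e
    rw [wd_cons, wd_cons, ← mul_sub, mul_assoc, mul_assoc, ← mul_assoc _ y, ih, mul_zero]
  | swap i j l =>
    intro y c e
    simp only [wd_cons, ← mul_assoc, ← sub_mul]
    rw [mul_assoc _ (wd K l) y, comm_mul_comm]
  | trans _ _ ih1 ih2 =>
    intro y c e
    have h1 := ih1 y c e
    have h2 := ih2 y c e
    rw [mul_assoc] at h1 h2 ⊢
    rw [← sub_add_sub_cancel, add_mul, h1, h2, add_zero]

lemma perm_right (K : Type*) [Field K] {d : ℕ} {p q : List (Fin d)} (h : p.Perm q)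
    (z : FreeMetab K d) (hz : ∀ y c e : FreeMetab K d, z * y * (c * e - e * c) = 0) :
    ∀ y, z * y * (wd K p - wd K q) = 0 := by
  induction h with
  | nil => intro y; simp
  | cons i _ ih =>
    intro y
    rw [wd_cons, wd_cons, ← mul_sub, ← mul_assoc, mul_assoc z y, ih]
  | swap i j l =>
    intro y
    simp only [wd_cons, ← mul_assoc, ← sub_mul]
    rw [hz, zero_mul]
  | trans _ _ ih1 ih2 =>
    intro y
    rw [← sub_add_sub_cancel, mul_add, ih1 y, ih2 y, add_zero]

lemma perm_perm (K : Type*) [Field K] {d : ℕ} {p q p' q' : List (Fin d)} (h : p.Perm q)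
    (h' : p'.Perm q') : (wd K p - wd K q) * (wd K p' - wd K q') = 0 := by
  simpa using perm_right K h' _ (perm_left K h) 1

/-- The element of `F_d` attached to an edge. -/
def phi (K : Type*) [Field K] {d : ℕ} (e : Edge d) : FreeMetab K d :=
  wd K (srt e.2.1 ++ e.1 :: srt e.2.2) - wd K (srt e.2.1 ++ srt (ev e.1 + e.2.2))

/-- Linear extension of `phi`. -/
def Phi (K : Type*) [Field K] (d : ℕ) : (Edge d →₀ K) →ₗ[K] FreeMetab K d :=
  Finsupp.linearCombination K (phi K)

lemma word_eq (K : Type*) [Field K] {d : ℕ} (w p : List (Fin d)) :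
    wd K (p ++ w) = wd K (p ++ srt (deg w)) + Phi K d (path K (deg p) w 0) := by
  induction w generalizing p with
  | nil => simp [path, deg_nil, srt_zero]
  | cons i w ih =>
    have h := ih (p ++ [i])
    have hp : deg (p ++ [i]) = deg p + ev i := by
      rw [deg_append, deg_cons, deg_nil, add_zero]
    rw [hp] at h
    simp only [List.append_assoc, List.singleton_append] at h
    rw [h, path, map_add, add_zero, deg_cons]
    have h1 : Phi K d (Finsupp.single ⟨i, deg p, deg w⟩ 1) = phi K ⟨i, deg p, deg w⟩ := by
      simp [Phi]
    have h2 := perm_perm K (perm_of_deg (deg_srt (deg p)).symm)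
      (perm_of_deg (l := i :: srt (deg w)) (m := srt (ev i + deg w))
        (by rw [deg_cons, deg_srt, deg_srt]))
    rw [h1, phi]
    simp only [wd_append, sub_mul, mul_sub] at h2 ⊢
    rw [← add_assoc]
    congr 1
    rw [← sub_eq_zero, ← h2]
    abel

/-- Auxiliary commutative ring `K[u,v,t]`. -/
abbrev S (K : Type*) [Field K] (d : ℕ) := AddMonoidAlgebra K (N d × N d × N d)

/-- The exponent of the monomial of an edge. -/
def expo {d : ℕ} (e : Edge d) : N d × N d × N d := (e.2.1, e.2.2, ev e.1)

lemma expo_inj {d : ℕ} : Function.Injective (expo (d := d)) := by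
  rintro ⟨i, a, b⟩ ⟨j, a', b'⟩ h
  simp only [expo, Prod.mk.injEq] at h
  obtain ⟨h1, h2, h3⟩ := h
  have := Finsupp.single_left_injective one_ne_zero h3
  subst this h1 h2
  rfl

/-- Edge vectors as polynomials. -/
def kap (K : Type*) [Field K] (d : ℕ) : (Edge d →₀ K) →ₗ[K] S K d :=
  Finsupp.linearCombination K (fun e => AddMonoidAlgebra.single (expo e) 1)

lemma kap_single (K : Type*) [Field K] {d : ℕ} (e : Edge d) :
    kap K d (Finsupp.single e 1) = AddMonoidAlgebra.single (expo e) 1 := by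
  simp [kap]

lemma kap_coeff (K : Type*) [Field K] {d : ℕ} (x : Edge d →₀ K) :
    (kap K d x).coeff = Finsupp.mapDomain expo x := by
  induction x using Finsupp.induction_linear with
  | zero => simp
  | add f g hf hg => simp [hf, hg, Finsupp.mapDomain_add]
  | single e c => simp [kap, Finsupp.mapDomain_single]

lemma kap_inj (K : Type*) [Field K] {d : ℕ} : Function.Injective (kap K d) := by
  intro x y h
  apply Finsupp.mapDomain_injective expo_inj
  rw [← kap_coeff, ← kap_coeff, h]

/-- The generic triangular representation on the free algebra. -/
def rho (K : Type*) [Field K] (d : ℕ) : FreeAlgebra K (Fin d) →ₐ[K] Matrix (Fin 2) (Fin 2) (S K d) :=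
  FreeAlgebra.lift K (fun i => !![AddMonoidAlgebra.single (ev i, 0, 0) 1,
    AddMonoidAlgebra.single (0, 0, ev i) 1; 0, AddMonoidAlgebra.single (0, ev i, 0) 1])

lemma rho_low (K : Type*) [Field K] {d : ℕ} (a : FreeAlgebra K (Fin d)) : rho K d a 1 0 = 0 := by
  induction a using FreeAlgebra.induction with
  | grade0 r => simp [Matrix.algebraMap_matrix_apply]
  | grade1 i => simp [rho]
  | mul a b ha hb => simp [Matrix.mul_apply, Fin.sum_univ_two, ha, hb]
  | add a b ha hb => simp [ha, hb]

lemma rho_rel (K : Type*) [Field K] {d : ℕ} ⦃x y : FreeAlgebra K (Fin d)⦄ (h : MetabRel K d x y) :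
    rho K d x = rho K d y := by
  obtain ⟨rfl, a, b, c, e, rfl⟩ := h
  have ha := rho_low K a
  have hb := rho_low K b
  have hc := rho_low K c
  have he := rho_low K e
  refine Matrix.ext fun i j => ?_
  simp only [map_mul, map_sub, map_zero]
  fin_cases i <;> fin_cases j <;>
    simp [Matrix.mul_apply, Fin.sum_univ_two, ha, hb, hc, he] <;> first | ring1 | (left; ring1)

lemma mul_kap_path (K : Type*) [Field K] {d : ℕ} (i : Fin d) (w : List (Fin d)) (a b : N d) :
    AddMonoidAlgebra.single (ev i, 0, 0) 1 * kap K d (path K a w b)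
      = kap K d (path K (a + ev i) w b) := by
  induction w generalizing a with
  | nil => simp [path]
  | cons j w ih =>
    rw [path, path, map_add, map_add, mul_add, ih, kap_single, kap_single,
      AddMonoidAlgebra.single_mul_single, add_right_comm]
    congr 1
    simp [expo, add_comm]

lemma rho_diag (K : Type*) [Field K] {d : ℕ} (w : List (Fin d)) :
    rho K d (w.map (FreeAlgebra.ι K)).prod 1 1 = AddMonoidAlgebra.single (0, deg w, 0) 1 := by
  induction w with
  | nil => simp [deg_nil, AddMonoidAlgebra.one_def]; rfl
  | cons i w ih =>
    rw [List.map_cons, List.prod_cons, map_mul, Matrix.mul_apply, Fin.sum_univ_two, rho_low, ih,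
      deg_cons]
    simp [rho, AddMonoidAlgebra.single_mul_single]

lemma rho_corner (K : Type*) [Field K] {d : ℕ} (w : List (Fin d)) :
    rho K d (w.map (FreeAlgebra.ι K)).prod 0 1 = kap K d (path K 0 w 0) := by
  induction w with
  | nil => simp [path]
  | cons i w ih =>
    rw [List.map_cons, List.prod_cons, map_mul, Matrix.mul_apply, Fin.sum_univ_two, rho_diag, ih,
      path, map_add, kap_single]
    have h := mul_kap_path K i w 0 0
    have h0 : rho K d (FreeAlgebra.ι K i) 0 0 = AddMonoidAlgebra.single (ev i, 0, 0) 1 := by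
      simp [rho]
    have h1 : rho K d (FreeAlgebra.ι K i) 0 1 = AddMonoidAlgebra.single (0, 0, ev i) 1 := by
      simp [rho]
    rw [h0, h1, h, add_comm]
    simp [AddMonoidAlgebra.single_mul_single, expo]

lemma exists_psi (K : Type*) [Field K] (d : ℕ) :
    ∃ psi : FreeMetab K d →ₗ[K] (Edge d →₀ K), ∀ l, psi (wd K l) = path K 0 l 0 := by
  obtain ⟨g, hg⟩ := (kap K d).exists_leftInverse_of_injective
    (LinearMap.ker_eq_bot.2 (kap_inj K))
  refine ⟨g ∘ₗ (Matrix.entryLinearMap K (S K d) (0 : Fin 2) (1 : Fin 2)) ∘ₗ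
    (RingQuot.liftAlgHom K ⟨rho K d, rho_rel K⟩).toLinearMap, fun l => ?_⟩
  have : (RingQuot.liftAlgHom K ⟨rho K d, rho_rel K⟩) (wd K l)
      = rho K d (l.map (FreeAlgebra.ι K)).prod := by
    rw [← mk_word, RingQuot.liftAlgHom_mkAlgHom_apply]
  simp only [LinearMap.comp_apply, AlgHom.toLinearMap_apply, this, Matrix.entryLinearMap_apply,
    rho_corner]
  exact LinearMap.congr_fun hg _

lemma exists_eps (K : Type*) [Field K] (d : ℕ) :
    ∃ eps : FreeMetab K d →ₗ[K] K, ∀ l, eps (wd K l) = 1 := by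
  have h : ∀ ⦃x y : FreeAlgebra K (Fin d)⦄, MetabRel K d x y →
      FreeAlgebra.lift K (fun _ : Fin d => (1 : K)) x
        = FreeAlgebra.lift K (fun _ : Fin d => (1 : K)) y := by
    rintro x y ⟨rfl, a, b, c, e, rfl⟩
    simp only [map_mul, map_sub, map_zero]
    ring
  refine ⟨(RingQuot.liftAlgHom K ⟨FreeAlgebra.lift K (fun _ : Fin d => (1 : K)), h⟩).toLinearMap,
    fun l => ?_⟩
  rw [← mk_word, AlgHom.toLinearMap_apply, RingQuot.liftAlgHom_mkAlgHom_apply, map_list_prod,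
    List.map_map]
  apply List.prod_eq_one
  intro x hx
  simp at hx
  exact hx.2

/-- The total map into `K × K × edges`. -/
def bd (K : Type*) [Field K] (d : ℕ) : (Edge d →₀ K) →ₗ[K] (N d × N d →₀ K) :=
  Finsupp.linearCombination K (fun e =>
    Finsupp.single (e.2.1 + ev e.1, e.2.2) 1 - Finsupp.single (e.2.1, ev e.1 + e.2.2) 1)

lemma bd_single (K : Type*) [Field K] {d : ℕ} (i : Fin d) (a b : N d) :
    bd K d (Finsupp.single ⟨i, a, b⟩ 1)
      = Finsupp.single (a + ev i, b) 1 - Finsupp.single (a, ev i + b) 1 := by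
  simp [bd]

lemma bd_path (K : Type*) [Field K] {d : ℕ} (w : List (Fin d)) (a b : N d) :
    bd K d (path K a w b)
      = Finsupp.single (a + deg w, b) 1 - Finsupp.single (a, deg w + b) 1 := by
  induction w generalizing a with
  | nil => simp [path, deg_nil]
  | cons i w ih =>
    rw [path, map_add, bd_single, ih, deg_cons]
    simp only [add_assoc]
    abel

/-- Edges of total degree `n`. -/
def En {d : ℕ} (n : N d) : Finset (Edge d) :=
  Finset.univ.sigma fun i => if ev i ≤ n then Finset.HasAntidiagonal.antidiagonal (n - ev i) else ∅

lemma mem_En {d : ℕ} (n : N d) (i : Fin d) (a b : N d) :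
    (⟨i, a, b⟩ : Edge d) ∈ En n ↔ a + (ev i + b) = n := by
  simp only [En, Finset.mem_sigma, Finset.mem_univ, true_and]
  split_ifs with h
  · rw [Finset.HasAntidiagonal.mem_antidiagonal, eq_tsub_iff_add_eq_of_le h]
    rw [add_right_comm, add_assoc]
  · simp only [Finset.notMem_empty, false_iff]
    rintro rfl
    exact h (le_add_left le_self_add)

lemma path_mem (K : Type*) [Field K] {d : ℕ} (w : List (Fin d)) (n a b : N d)
    (h : a + (deg w + b) = n) :
    path K a w b ∈ Finsupp.supported K K (En n : Set (Edge d)) := by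
  induction w generalizing a with
  | nil => simp [path]
  | cons i w ih =>
    rw [path]
    rw [deg_cons] at h
    refine Submodule.add_mem _ (Finsupp.single_mem_supported K _ ?_) (ih _ ?_)
    · rw [Finset.mem_coe, mem_En, ← h, add_assoc]
    · rw [← h]; simp only [add_assoc]

/-- The vertex-to-end path map. -/
def Q (K : Type*) [Field K] (d : ℕ) : (N d × N d →₀ K) →ₗ[K] (Edge d →₀ K) :=
  Finsupp.linearCombination K (fun p => path K p.1 (srt p.2) 0)

lemma psi_Phi (K : Type*) [Field K] {d : ℕ} (psi : FreeMetab K d →ₗ[K] (Edge d →₀ K))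
    (hpsi : ∀ l, psi (wd K l) = path K 0 l 0) (v : Edge d →₀ K) :
    psi (Phi K d v) = v + Q K d (bd K d v) := by
  have : psi ∘ₗ Phi K d = LinearMap.id + Q K d ∘ₗ bd K d := by
    refine Finsupp.lhom_ext' fun e => LinearMap.ext_ring ?_
    obtain ⟨i, a, b⟩ := e
    simp only [LinearMap.comp_apply, Finsupp.lsingle_apply, LinearMap.add_apply,
      LinearMap.id_apply, bd_single, map_sub]
    simp only [Phi, Q, Finsupp.linearCombination_single, one_smul, phi, map_sub, hpsi,
      path_append, path, deg_cons, deg_srt, zero_add, add_zero]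
    abel
  exact LinearMap.congr_fun this v

/-- The cochain-type map whose kernel is the component. -/
def T (K : Type*) [Field K] {d : ℕ} (n : N d) :
    (K × K × (Finsupp.supported K K (En n : Set (Edge d)))) →ₗ[K] (N d × N d →₀ K) :=
  (LinearMap.toSpanSingleton K _ (Finsupp.single (0, n) 1)).coprod
    ((LinearMap.toSpanSingleton K _ (-Finsupp.single (n, 0) 1)).coprod
      (bd K d ∘ₗ Submodule.subtype _))

lemma T_apply (K : Type*) [Field K] {d : ℕ} (n : N d) (c c' : K)
    (v : Finsupp.supported K K (En n : Set (Edge d))) :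
    T K n (c, c', v) = c • Finsupp.single (0, n) 1 - c' • Finsupp.single (n, 0) 1
      + bd K d v := by
  simp [T, sub_eq_add_neg, add_assoc]

lemma range_T (K : Type*) [Field K] {d : ℕ} (n : N d) :
    LinearMap.range (T K n)
      = Finsupp.supported K K (Finset.HasAntidiagonal.antidiagonal n : Set (N d × N d)) := by
  apply le_antisymm
  · rintro _ ⟨⟨c, c', v, hv⟩, rfl⟩
    rw [T_apply]
    refine Submodule.add_mem _ (Submodule.sub_mem _ (Submodule.smul_mem _ _ ?_)
      (Submodule.smul_mem _ _ ?_)) ?_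
    · exact Finsupp.single_mem_supported K _ (by simp)
    · exact Finsupp.single_mem_supported K _ (by simp)
    · change bd K d v ∈ _
      rw [bd, Finsupp.linearCombination_apply]
      refine Submodule.sum_mem _ fun e he => Submodule.smul_mem _ _ ?_
      have h : e ∈ En n := hv he
      obtain ⟨i, a, b⟩ := e
      rw [mem_En] at h
      refine Submodule.sub_mem _ (Finsupp.single_mem_supported K _ ?_)
        (Finsupp.single_mem_supported K _ ?_)
      · simp [← h, add_assoc]
      · simp [← h]
  · rw [Finsupp.supported_eq_span_single, Submodule.span_le]
    rintro _ ⟨⟨a, b⟩, hab, rfl⟩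
    have hab' : a + b = n := by simpa using hab
    refine ⟨(0, -1, -⟨path K a (srt b) 0, path_mem K _ n a 0 (by simpa [deg_srt])⟩), ?_⟩
    rw [T_apply]
    simp [bd_path, deg_srt, hab']

lemma finrank_multiComp (K : Type*) [Field K] {d : ℕ} (n : N d) :
    Module.finrank K (multiComp K d n) + (Finset.HasAntidiagonal.antidiagonal n).card = (En n).card + 2 := by
  obtain ⟨psi, hpsi⟩ := exists_psi K d
  obtain ⟨eps, heps⟩ := exists_eps K d
  have hmem : ∀ l, deg l = n → wd K l ∈ multiComp K d n := by
    intro l hl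
    rw [multiComp_eq]
    exact Submodule.subset_span ⟨l, hl, rfl⟩
  have hbeta : ∀ w ∈ multiComp K d n, eps w • wd K (srt n) + Phi K d (psi w) = w := by
    intro w hw
    rw [multiComp_eq] at hw
    induction hw using Submodule.span_induction with
    | mem x hx =>
      obtain ⟨l, hl, rfl⟩ := hx
      have h := word_eq K l []
      simp only [List.nil_append, deg_nil, hl] at h
      rw [heps, hpsi, one_smul, ← h]
    | zero => simp
    | add x y _ _ hx hy =>
      rw [map_add, map_add, map_add, add_smul]
      nth_rewrite 3 [← hx]
      nth_rewrite 3 [← hy]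
      abel
    | smul c x _ hx =>
      rw [map_smul, map_smul, map_smul, smul_assoc, ← smul_add, hx]
  have hsupp : ∀ w ∈ multiComp K d n, psi w ∈ Finsupp.supported K K (En n : Set (Edge d)) := by
    intro w hw
    rw [multiComp_eq] at hw
    refine (Submodule.span_le (p := (Finsupp.supported K K (En n : Set (Edge d))).comap psi)).2
      ?_ hw
    rintro _ ⟨l, hl, rfl⟩
    simp only [SetLike.mem_coe, Submodule.mem_comap, hpsi]
    exact path_mem K l n 0 0 (by simpa)
  have hbd : ∀ w ∈ multiComp K d n,
      bd K d (psi w) = eps w • (Finsupp.single (n, 0) 1 - Finsupp.single (0, n) 1) := by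
    intro w hw
    rw [multiComp_eq] at hw
    refine LinearMap.eqOn_span (f := bd K d ∘ₗ psi)
      (g := (LinearMap.toSpanSingleton K _ (Finsupp.single (n, 0) 1 - Finsupp.single (0, n) 1))
        ∘ₗ eps) ?_ hw
    rintro _ ⟨l, hl, rfl⟩
    simp [hpsi, heps, bd_path, hl]
  have hPhi : ∀ v ∈ Finsupp.supported K K (En n : Set (Edge d)),
      Phi K d v ∈ multiComp K d n ∧ eps (Phi K d v) = 0 := by
    intro v hv
    rw [Phi, Finsupp.linearCombination_apply, Finsupp.sum]
    constructor
    · refine Submodule.sum_mem _ fun e he => Submodule.smul_mem _ _ ?_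
      have h : e ∈ En n := hv he
      obtain ⟨i, a, b⟩ := e
      rw [mem_En] at h
      refine Submodule.sub_mem _ (hmem _ ?_) (hmem _ ?_)
      · simp [deg_append, deg_cons, deg_srt, h]
      · simp [deg_append, deg_srt, h]
    · rw [map_sum]
      refine Finset.sum_eq_zero fun e _ => ?_
      rw [map_smul, phi, map_sub, heps, heps, sub_self, smul_zero]
  let Lam : multiComp K d n →ₗ[K] (K × K × (Finsupp.supported K K (En n : Set (Edge d)))) :=
    (eps.domRestrict _).prod ((eps.domRestrict _).prod
      ((psi.domRestrict _).codRestrict _ (fun w => hsupp w.1 w.2)))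
  have hinj : Function.Injective Lam := by
    rintro ⟨w, hw⟩ ⟨w', hw'⟩ h
    have h1 : eps w = eps w' := congrArg Prod.fst h
    have h2 : psi w = psi w' := congrArg (fun x => (x.2.2 : Edge d →₀ K)) h
    have h3 := hbeta w hw
    rw [h1, h2, hbeta w' hw'] at h3
    exact Subtype.ext h3.symm
  have hrange : LinearMap.range Lam = LinearMap.ker (T K n) := by
    apply le_antisymm
    · rintro _ ⟨⟨w, hw⟩, rfl⟩
      rw [LinearMap.mem_ker]
      change T K n (eps w, eps w, ⟨psi w, hsupp w hw⟩) = 0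
      rw [T_apply]
      simp only [hbd w hw, smul_sub]
      abel
    · rintro ⟨c, c', v, hv⟩ h
      rw [LinearMap.mem_ker, T_apply] at h
      simp only at h
      have hcc : c = c' := by
        have h0 : (Finsupp.linearCombination K (fun _ : N d × N d => (1 : K))) (bd K d v) = 0 := by
          have : (Finsupp.linearCombination K (fun _ : N d × N d => (1 : K))) ∘ₗ bd K d = 0 := by
            refine Finsupp.lhom_ext' fun e => LinearMap.ext_ring ?_
            obtain ⟨i, a, b⟩ := e
            simp [bd_single]
          exact LinearMap.congr_fun this v
        have h1 := congrArg (Finsupp.linearCombination K (fun _ : N d × N d => (1 : K))) h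
        rw [map_add, h0] at h1
        simp at h1
        exact sub_eq_zero.1 h1
      subst hcc
      have hb : bd K d v = c • Finsupp.single (n, 0) 1 - c • Finsupp.single (0, n) 1 := by
        rw [← sub_eq_zero, ← h]; abel
      obtain ⟨hP1, hP2⟩ := hPhi v hv
      have hw : c • wd K (srt n) + Phi K d v ∈ multiComp K d n :=
        Submodule.add_mem _ (Submodule.smul_mem _ _ (hmem _ (deg_srt n))) hP1
      refine ⟨⟨_, hw⟩, ?_⟩
      have e1 : eps (c • wd K (srt n) + Phi K d v) = c := by
        rw [map_add, map_smul, hP2, heps]; simp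
      have e2 : psi (c • wd K (srt n) + Phi K d v) = v := by
        rw [map_add, map_smul, psi_Phi K psi hpsi, hpsi, hb]
        simp [Q, srt_zero, path]
      exact Prod.ext e1 (Prod.ext e1 (Subtype.ext e2))
  have hfs : ∀ {ι : Type} (s : Finset ι),
      Module.finrank K (Finsupp.supported K K (s : Set ι)) = s.card ∧
      Module.Finite K (Finsupp.supported K K (s : Set ι)) ∧
      Module.Free K (Finsupp.supported K K (s : Set ι)) := by
    intro ι s
    have e := Finsupp.supportedEquivFinsupp (M := K) (R := K) (s : Set ι)
    refine ⟨?_, Module.Finite.equiv e.symm, Module.Free.of_equiv e.symm⟩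
    rw [e.finrank_eq, Module.finrank_finsupp_self]
    simp
  have := (hfs (En n)).2.1
  have := (hfs (En n)).2.2
  have h1 := LinearMap.finrank_range_of_inj hinj
  have h2 := LinearMap.finrank_range_add_finrank_ker (K := K)
    (V := K × K × (Finsupp.supported K K (En n : Set (Edge d)))) (V₂ := N d × N d →₀ K) (T K n)
  rw [hrange] at h1
  rw [h1, range_T, (hfs (Finset.HasAntidiagonal.antidiagonal n)).1, Module.finrank_prod, Module.finrank_prod,
    (hfs (En n)).1, Module.finrank_self] at h2
  omega

/-- The series whose coefficients are all one. -/
def PS (d : ℕ) : MvPowerSeries (Fin d) ℤ := fun _ => 1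

lemma coeff_PS {d : ℕ} (n : N d) : MvPowerSeries.coeff n (PS d) = 1 := rfl

/-- Indicator series of the exponents vanishing on `s`. -/
def Ind {d : ℕ} (s : Finset (Fin d)) : MvPowerSeries (Fin d) ℤ :=
  fun n => if ∀ j ∈ s, n j = 0 then 1 else 0

lemma coeff_Ind {d : ℕ} (s : Finset (Fin d)) (n : N d) :
    MvPowerSeries.coeff n (Ind s) = if ∀ j ∈ s, n j = 0 then 1 else 0 := rfl

lemma prod_PS (d : ℕ) (s : Finset (Fin d)) :
    (∏ j ∈ s, (1 - MvPowerSeries.X j : MvPowerSeries (Fin d) ℤ)) * PS d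
      = Ind s := by
  induction s using Finset.induction_on with
  | empty => ext n; simp [coeff_PS, coeff_Ind]
  | insert i s hi ih =>
    rw [Finset.prod_insert hi, mul_assoc, ih]
    ext n
    rw [sub_mul, one_mul, map_sub, MvPowerSeries.X, MvPowerSeries.coeff_monomial_mul]
    simp only [coeff_Ind, one_mul, Finsupp.single_le_iff]
    have hn : ∀ j ∈ s, (n - Finsupp.single i 1 : N d) j = n j := by
      intro j hj
      have : i ≠ j := fun h => hi (h ▸ hj)
      simp [Finsupp.single_apply, this]
    have h1 : (∀ j ∈ s, (n - Finsupp.single i 1 : N d) j = 0) ↔ ∀ j ∈ s, n j = 0 :=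
      forall₂_congr fun j hj => by rw [hn j hj]
    simp only [h1, Finset.forall_mem_insert]
    by_cases hs : ∀ j ∈ s, n j = 0
    · by_cases h0 : n i = 0
      · simp [hs, h0]
      · simp [hs, h0, Nat.one_le_iff_ne_zero]
    · simp [hs]

lemma prod_PS_univ (d : ℕ) :
    (∏ j : Fin d, (1 - MvPowerSeries.X j : MvPowerSeries (Fin d) ℤ)) * PS d = 1 := by
  rw [prod_PS]
  ext n
  rw [MvPowerSeries.coeff_one, coeff_Ind]
  simp [Finsupp.ext_iff]

lemma coeff_PS_sq {d : ℕ} (n : N d) :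
    MvPowerSeries.coeff n (PS d * PS d) = ((Finset.HasAntidiagonal.antidiagonal n).card : ℤ) := by
  rw [MvPowerSeries.coeff_mul]
  simp [coeff_PS]

lemma hilbert_eq (K : Type*) [Field K] (d : ℕ) :
    hilbertF K d = 2 * PS d
      + ((∑ j : Fin d, (MvPowerSeries.X j : MvPowerSeries (Fin d) ℤ)) - 1) * (PS d * PS d) := by
  ext n
  have h := finrank_multiComp K n
  have hE : ((En n).card : ℤ) = MvPowerSeries.coeff n
      ((∑ j : Fin d, (MvPowerSeries.X j : MvPowerSeries (Fin d) ℤ)) * (PS d * PS d)) := by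
    rw [Finset.sum_mul, map_sum, En, Finset.card_sigma]
    push_cast
    refine Finset.sum_congr rfl fun i _ => ?_
    rw [MvPowerSeries.X, MvPowerSeries.coeff_monomial_mul, one_mul, coeff_PS_sq]
    change _ = if ev i ≤ n then (((Finset.HasAntidiagonal.antidiagonal (n - ev i)).card : ℕ) : ℤ) else 0
    split_ifs <;> simp
  rw [sub_mul, one_mul, map_add, map_sub, ← hE, coeff_PS_sq, two_mul, map_add, coeff_PS]
  change ((Module.finrank K (multiComp K d n) : ℕ) : ℤ) = _
  omega

end HSM

/-- The multigraded Hilbert series of the free metabelian associative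
algebra satisfies
`∏ (1-z_j)² · H(F_d,z₁,…,z_d) = 2·∏ (1-z_j) + (z₁+⋯+z_d-1)`,
i.e. `H(F_d,z) = ∏(1-z_j)⁻¹·(2 + (z₁+⋯+z_d-1)·∏(1-z_j)⁻¹)`. -/
theorem hilbert_series_free_metabelian
    (K : Type*) [Field K] [CharZero K] (d : ℕ) (hd : 2 ≤ d) :
    (∏ j : Fin d, (1 - MvPowerSeries.X j : MvPowerSeries (Fin d) ℤ)) ^ 2 * hilbertF K d
      = 2 * (∏ j : Fin d, (1 - MvPowerSeries.X j : MvPowerSeries (Fin d) ℤ))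
        + ((∑ j : Fin d, (MvPowerSeries.X j : MvPowerSeries (Fin d) ℤ)) - 1) := by
  rw [HSM.hilbert_eq]
  have h := HSM.prod_PS_univ d
  generalize (∏ j : Fin d, (1 - MvPowerSeries.X j : MvPowerSeries (Fin d) ℤ)) = p at h ⊢
  generalize HSM.PS d = q at h ⊢
  generalize (∑ j : Fin d, (MvPowerSeries.X j : MvPowerSeries (Fin d) ℤ)) = s
  linear_combination (2 * p + (s - 1) * (p * q + 1)) * h
end
end
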